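/- arXiv:1311.2571 — 9 statements merged into one kernel-verified Lean document; each statement's English description precedes it below -/
import Mathlib

section
/- Let d ≥ 1 be a fixed integer and let n ≥ d. If the correlation polytope COR(n) admits a (S^d_+)^r-lift for some r ∈ ℕ — that is, COR(n) is the image under a linear map π of the intersection of the cone (S^d_+)^r (r-fold Cartesian product of the cone of d×d real positive semidefinite matrices) with an affine subspace — then r ≥ κ(d)·c(d)^n, where c(d) = (1 − 1/3^d)^{−1/d} and κ(d) = (3^d − 1)^{−(1−1/d)}. -/
/-- The correlation polytope `COR(n) = conv{ bbᵀ : b ∈ {0,1}ⁿ } ⊆ ℝ^{n×n}`. -/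
noncomputable def COR (n : ℕ) : Set (Matrix (Fin n) (Fin n) ℝ) :=
  convexHull ℝ {X | ∃ b : Fin n → Bool,
    X = Matrix.of fun i j => (if b i then (1 : ℝ) else 0) * (if b j then (1 : ℝ) else 0)}

/-- `P ⊆ ℝ^{n×n}` admits an `(S^d_+)^r`-lift: `P` is the image under a linear map `π`
of the intersection of the cone `(S^d_+)^r` (tuples of `r` positive semidefinite
`d × d` matrices) with an affine subspace `L`. -/
def HasPsdProductLift (n d r : ℕ) (P : Set (Matrix (Fin n) (Fin n) ℝ)) : Prop :=
  ∃ (L : AffineSubspace ℝ (Fin r → Matrix (Fin d) (Fin d) ℝ))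
    (π : (Fin r → Matrix (Fin d) (Fin d) ℝ) →ₗ[ℝ] Matrix (Fin n) (Fin n) ℝ),
    P = π '' ({X | ∀ i, (X i).PosSemidef} ∩ (L : Set (Fin r → Matrix (Fin d) (Fin d) ℝ)))

namespace TernaryWord

/-- A word in `{0, 1, 2}ⁿ` encodes the disjoint pair `({i | w i = 1}, {i | w i = 2})`.
`meet v w` is the size of the intersection of the first set of `v` with the second set of `w`. -/
def meet {n : ℕ} (v w : Fin n → Fin 3) : ℕ := ∑ i, if v i = 1 ∧ w i = 2 then 1 else 0

theorem meet_self {n : ℕ} (v : Fin n → Fin 3) : meet v v = 0 := by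
  refine Finset.sum_eq_zero fun i _ => if_neg ?_
  rintro ⟨h, h'⟩
  simp [h] at h'

theorem meet_cons {n : ℕ} (x y : Fin 3) (v w : Fin n → Fin 3) :
    meet (Fin.cons x v) (Fin.cons y w : Fin (n + 1) → Fin 3) =
      (if x = 1 ∧ y = 2 then 1 else 0) + meet v w := by
  simp only [meet, Fin.sum_univ_succ, Fin.cons_zero, Fin.cons_succ]

/-- In a chain, the first set of a word meets the second set of each later word
in exactly one element. -/
def IsChain {n : ℕ} (l : List (Fin n → Fin 3)) : Prop := l.Pairwise fun v w => meet v w = 1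

/-- The words starting with `x` in a family, with that letter removed. -/
def slice {n : ℕ} (S : Finset (Fin (n + 1) → Fin 3)) (x : Fin 3) : Finset (Fin n → Fin 3) :=
  Finset.univ.filter fun w => Fin.cons x w ∈ S

@[simp] theorem mem_slice {n : ℕ} {S : Finset (Fin (n + 1) → Fin 3)} {x : Fin 3}
    {w : Fin n → Fin 3} : w ∈ slice S x ↔ Fin.cons x w ∈ S := by
  simp [slice]

theorem card_eq_sum_slice {n : ℕ} (S : Finset (Fin (n + 1) → Fin 3)) :
    S.card = ∑ x, (slice S x).card := by
  have h (T : Finset (Fin (n + 1) → Fin 3)) : T.card = ∑ w, if w ∈ T then 1 else 0 := by simp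
  rw [h, ← (Fin.consEquiv fun _ => Fin 3).sum_comp, Fintype.sum_prod_type]
  simp only [Fin.consEquiv, slice, Finset.card_filter, Equiv.coe_fn_mk]
  rfl

/-- The number of words of length `n` over a three-letter alphabet in which a given letter
occurs fewer than `d` times. -/
def boundCount : ℕ → ℕ → ℕ
  | 0, _ => 0
  | _ + 1, 0 => 1
  | d + 1, n + 1 => 2 * boundCount (d + 1) n + boundCount d n

theorem card_slices_le {α : Type*} [DecidableEq α] (A B C : Finset α) :
    A.card + B.card + C.card ≤ (A ∪ B).card + (A ∪ C).card + (A ∩ B ∩ C).card := by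
  have h₁ := Finset.card_union_add_card_inter A B
  have h₂ := Finset.card_union_add_card_inter A C
  have h₃ := Finset.card_union_add_card_inter (A ∩ B) (A ∩ C)
  have h₄ : ((A ∩ B) ∪ (A ∩ C)).card ≤ A.card := Finset.card_le_card (by grind)
  have h₅ : (A ∩ B) ∩ (A ∩ C) = A ∩ B ∩ C := by grind
  rw [h₅] at h₃
  omega

theorem exists_chain_of_map {n : ℕ} {S : Finset (Fin (n + 1) → Fin 3)} {x y : Fin 3}
    (hxy : ¬ ((x = 1 ∨ y = 1) ∧ (x = 2 ∨ y = 2))) {l : List (Fin n → Fin 3)} (hl : IsChain l)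
    (hS : ∀ w ∈ l, w ∈ slice S x ∪ slice S y) :
    ∃ l' : List (Fin (n + 1) → Fin 3), IsChain l' ∧ l'.length = l.length ∧ ∀ w ∈ l', w ∈ S := by
  let f : (Fin n → Fin 3) → Fin (n + 1) → Fin 3 := fun w =>
    Fin.cons (if w ∈ slice S x then x else y) w
  refine ⟨l.map f, ?_, by simp, ?_⟩
  · refine List.Pairwise.map f (fun v w h => ?_) hl
    simp only [f, meet_cons, h]
    grind
  · intro w hw
    obtain ⟨v, hv, rfl⟩ := List.mem_map.1 hw
    have := hS v hv
    simp only [f]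
    split_ifs with h
    · simpa using h
    · simpa [h] using this

/-- A family of words without chains of `d + 1` words is small. -/
theorem card_le_boundCount (n d : ℕ) (S : Finset (Fin n → Fin 3))
    (hS : ∀ l : List (Fin n → Fin 3), IsChain l → (∀ w ∈ l, w ∈ S) → l.length ≤ d) :
    S.card ≤ boundCount d n := by
  induction n generalizing d with
  | zero =>
    cases d with
    | zero =>
      have : S = ∅ := Finset.eq_empty_of_forall_notMem fun w hw => by
        simpa using hS [w] (List.pairwise_singleton _ _) (by simpa using hw)
      simp [this]
    | succ d => simpa [boundCount] using Finset.card_le_univ S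
  | succ n ih =>
    cases d with
    | zero =>
      have : S = ∅ := Finset.eq_empty_of_forall_notMem fun w hw => by
        simpa using hS [w] (List.pairwise_singleton _ _) (by simpa using hw)
      simp [this]
    | succ d =>
      have union_le {x y : Fin 3} (hxy : ¬ ((x = 1 ∨ y = 1) ∧ (x = 2 ∨ y = 2))) :
          (slice S x ∪ slice S y).card ≤ boundCount (d + 1) n := by
        refine ih _ _ fun l hl hlS => ?_
        obtain ⟨l', hl', hlen, hmem⟩ := exists_chain_of_map hxy hl hlS
        exact hlen ▸ hS l' hl' hmem
      have inter_le : (slice S 0 ∩ slice S 1 ∩ slice S 2).card ≤ boundCount d n := by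
        refine ih _ _ fun l hl hlS => ?_
        cases l with
        | nil => simp
        | cons w l =>
          simp only [List.mem_cons, Finset.mem_inter, mem_slice, forall_eq_or_imp] at hlS
          obtain ⟨hw, hl'⟩ := List.pairwise_cons.1 hl
          have key := hS (Fin.cons 1 w :: Fin.cons 2 w :: l.map (Fin.cons 0)) ?_ ?_
          · simpa using key
          · have h0 : IsChain (l.map (Fin.cons 0 : _ → Fin (n + 1) → Fin 3)) :=
              List.Pairwise.map _ (fun u v h => by simp [meet_cons, h]) hl'
            refine List.pairwise_cons.2 ⟨?_, List.pairwise_cons.2 ⟨?_, h0⟩⟩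
            · simp only [List.mem_cons, List.mem_map, forall_eq_or_imp]
              refine ⟨by simp [meet_cons, meet_self], ?_⟩
              rintro _ ⟨v, hv, rfl⟩
              simp [meet_cons, hw v hv]
            · simp only [List.mem_map]
              rintro _ ⟨v, hv, rfl⟩
              simp [meet_cons, hw v hv]
          · simp only [List.mem_cons, List.mem_map, forall_eq_or_imp]
            refine ⟨hlS.1.1.2, hlS.1.2, ?_⟩
            rintro _ ⟨v, hv, rfl⟩
            exact (hlS.2 v hv).1.1
      have h₁ := union_le (x := 0) (y := 1) (by decide)
      have h₂ := union_le (x := 0) (y := 2) (by decide)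
      have h₃ := card_slices_le (slice S 0) (slice S 1) (slice S 2)
      rw [card_eq_sum_slice, Fin.sum_univ_three, boundCount]
      omega

theorem boundCount_one (n : ℕ) : boundCount 1 n = 2 ^ n := by
  induction n with
  | zero => rfl
  | succ n ih => simp [boundCount, ih, pow_succ, mul_comm]

theorem boundCount_le_pow {m : ℝ} (hm : 2 + 1 / m ≤ m) (hm₂ : 2 ≤ m) (d n : ℕ) :
    (boundCount (d + 1) n : ℝ) ≤ m ^ (n + d) := by
  have hm₀ : 0 < m := by linarith
  induction n generalizing d with
  | zero => simpa [boundCount] using one_le_pow₀ (by linarith : (1 : ℝ) ≤ m)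
  | succ n ih =>
    cases d with
    | zero =>
      rw [boundCount_one]
      push_cast
      exact pow_le_pow_left₀ (by norm_num) hm₂ _
    | succ d =>
      have h₁ := ih (d + 1)
      have h₂ := ih d
      rw [boundCount]
      push_cast
      calc 2 * (boundCount (d + 2) n : ℝ) + boundCount (d + 1) n
          ≤ 2 * m ^ (n + (d + 1)) + m ^ (n + d) := by gcongr
        _ = m ^ (n + (d + 1)) * (2 + 1 / m) := by
          field_simp
          ring
        _ ≤ m ^ (n + (d + 1)) * m := by gcongr
        _ = m ^ (n + 1 + (d + 1)) := by ring

/-- With `m = (3^d - 1)^(1/d)` one has `boundCount d n ≤ m^(n + d - 1)`. -/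
theorem boundCount_le_rpow {d : ℕ} (hd : 1 ≤ d) (n : ℕ) :
    (boundCount d n : ℝ) ≤ (((3 : ℝ) ^ d - 1) ^ (1 / (d : ℝ))) ^ (n + (d - 1)) := by
  obtain ⟨e, rfl⟩ := Nat.exists_eq_add_of_le' hd
  cases e with
  | zero => norm_num [boundCount_one]
  | succ e =>
    have h (k : ℕ) : (5 / 2 : ℝ) ^ (k + 2) ≤ 3 ^ (k + 2) - 1 := by
      induction k with
      | zero => norm_num
      | succ k ih =>
        have : (1 : ℝ) ≤ 3 ^ (k + 2) := one_le_pow₀ (by norm_num)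
        rw [pow_succ, pow_succ (3 : ℝ)]
        linarith
    set m : ℝ := ((3 : ℝ) ^ (e + 2) - 1) ^ (1 / ((e + 2 : ℕ) : ℝ)) with hm
    have hm' : 5 / 2 ≤ m := by
      calc (5 / 2 : ℝ) = ((5 / 2 : ℝ) ^ (e + 2)) ^ (1 / ((e + 2 : ℕ) : ℝ)) := by
            rw [one_div, Real.pow_rpow_inv_natCast (by norm_num) (by omega)]
        _ ≤ m := Real.rpow_le_rpow (by positivity) (h e) (by positivity)
    refine boundCount_le_pow ?_ (by linarith) (e + 1) n
    have : 1 / m ≤ 1 / (5 / 2) := one_div_le_one_div_of_le (by norm_num) hm'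
    linarith

end TernaryWord

namespace Matrix.PosSemidef

variable {ι : Type*} [Fintype ι]

theorem exists_sq_le_of_mem_span {E κ : Type*} [AddCommGroup E] [Module ℝ E] [Fintype κ]
    {z : κ → E →ₗ[ℝ] ℝ} {f : E →ₗ[ℝ] ℝ} (hf : f ∈ Submodule.span ℝ (Set.range z)) :
    ∃ C : ℝ, 0 ≤ C ∧ ∀ v, f v ^ 2 ≤ C * ∑ j, z j v ^ 2 := by
  obtain ⟨c, rfl⟩ := (Submodule.mem_span_range_iff_exists_fun ℝ).1 hf
  refine ⟨∑ j, c j ^ 2, by positivity, fun v => ?_⟩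
  simpa using Finset.sum_mul_sq_le_sq_mul_sq Finset.univ c fun j => z j v

/-- If `ker Z ⊆ ker Y` for positive semidefinite `Y`, `Z`, then `Z` dominates a positive
multiple of `Y`. -/
theorem eventually_sub_smul {Y Z : Matrix ι ι ℝ} (hY : Y.PosSemidef) (hZ : Z.PosSemidef)
    (hker : ∀ v, Z *ᵥ v = 0 → Y *ᵥ v = 0) :
    ∀ᶠ ε : ℝ in nhdsWithin 0 (Set.Ioi 0), (Z - ε • Y).PosSemidef := by
  obtain ⟨p, y, hy⟩ := Matrix.posSemidef_iff_eq_sum_vecMulVec.1 hY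
  obtain ⟨q, z, hz⟩ := Matrix.posSemidef_iff_eq_sum_vecMulVec.1 hZ
  let fy : Fin p → (ι → ℝ) →ₗ[ℝ] ℝ := fun i => dotProductBilin ℝ ℝ (y i)
  let fz : Fin q → (ι → ℝ) →ₗ[ℝ] ℝ := fun i => dotProductBilin ℝ ℝ (z i)
  have quad {s : ℕ} (u : Fin s → ι → ℝ) (v : ι → ℝ) :
      v ⬝ᵥ ((∑ i, vecMulVec (u i) (star (u i))) *ᵥ v) = ∑ i, (u i ⬝ᵥ v) ^ 2 := by
    simp only [sum_mulVec, dotProduct_sum, vecMulVec_mulVec, star_trivial]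
    refine Finset.sum_congr rfl fun i _ => ?_
    simp [dotProduct_comm v, sq]
  have hqY (v : ι → ℝ) : v ⬝ᵥ (Y *ᵥ v) = ∑ i, fy i v ^ 2 := by rw [hy]; exact quad y v
  have hqZ (v : ι → ℝ) : v ⬝ᵥ (Z *ᵥ v) = ∑ i, fz i v ^ 2 := by rw [hz]; exact quad z v
  have hspan (i : Fin p) : fy i ∈ Submodule.span ℝ (Set.range fz) := by
    refine mem_span_of_iInf_ker_le_ker fun v hv => ?_
    simp only [Submodule.mem_iInf, LinearMap.mem_ker] at hv ⊢
    have hZv : Z *ᵥ v = 0 := (hZ.dotProduct_mulVec_zero_iff v).1 (by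
      rw [star_trivial, hqZ]
      simp [hv])
    have h := hqY v
    rw [hker v hZv, dotProduct_zero, eq_comm,
      Finset.sum_eq_zero_iff_of_nonneg fun _ _ => sq_nonneg _] at h
    simpa using h i (Finset.mem_univ i)
  choose C hC₀ hC using fun i => exists_sq_le_of_mem_span (hspan i)
  have hC' : 0 ≤ ∑ i, C i := Finset.sum_nonneg fun i _ => hC₀ i
  have hpos : (0 : ℝ) < 1 / (∑ i, C i + 1) := by positivity
  filter_upwards [Ioo_mem_nhdsGT hpos] with ε hε
  refine .of_dotProduct_mulVec_nonneg ?_ fun v => ?_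
  · exact hZ.1.sub (hY.smul hε.1.le).1
  · rw [star_trivial, sub_mulVec, dotProduct_sub, smul_mulVec, dotProduct_smul, hqY, hqZ,
      smul_eq_mul, sub_nonneg]
    have hs : 0 ≤ ∑ j, fz j v ^ 2 := by positivity
    have hε' : ε * ∑ i, C i ≤ 1 := by
      have := (lt_div_iff₀ (by positivity)).1 hε.2
      nlinarith [hε.1]
    calc ε * ∑ i, fy i v ^ 2 ≤ ε * ∑ i, C i * ∑ j, fz j v ^ 2 :=
          mul_le_mul_of_nonneg_left (Finset.sum_le_sum fun i _ => hC i v) hε.1.le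
      _ = (ε * ∑ i, C i) * ∑ j, fz j v ^ 2 := by rw [← Finset.sum_mul, mul_assoc]
      _ ≤ 1 * ∑ j, fz j v ^ 2 := mul_le_mul_of_nonneg_right hε' hs
      _ = _ := one_mul _

theorem mulVec_eq_zero_of_sum {κ : Type*} {s : Finset κ} {Y : κ → Matrix ι ι ℝ}
    (hY : ∀ k, (Y k).PosSemidef) {v : ι → ℝ} (hv : (∑ k ∈ s, Y k) *ᵥ v = 0) {k : κ} (hk : k ∈ s) :
    Y k *ᵥ v = 0 := by
  rw [← (hY k).dotProduct_mulVec_zero_iff]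
  have h : ∑ k ∈ s, star v ⬝ᵥ (Y k *ᵥ v) = 0 := by
    rw [← dotProduct_sum, ← sum_mulVec, hv, dotProduct_zero]
  exact (Finset.sum_eq_zero_iff_of_nonneg fun k _ => (hY k).dotProduct_mulVec_nonneg v).1 h k hk

end Matrix.PosSemidef

namespace COR

variable {n : ℕ}

/-- The vertex `bbᵀ` of the correlation polytope. -/
def vertex (b : Fin n → Bool) : Matrix (Fin n) (Fin n) ℝ :=
  Matrix.of fun i j => (if b i then (1 : ℝ) else 0) * (if b j then (1 : ℝ) else 0)

theorem vertex_mem (b : Fin n → Bool) : vertex b ∈ COR n := subset_convexHull ℝ _ ⟨b, rfl⟩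

/-- The linear functional `X ↦ ⟨2 diag(a) - aaᵀ, X⟩`, which is at most `1` on `COR n`. -/
def functional (a : Fin n → ℝ) : Matrix (Fin n) (Fin n) ℝ →ₗ[ℝ] ℝ where
  toFun X := 2 * ∑ i, a i * X i i - ∑ i, ∑ j, a i * a j * X i j
  map_add' X Y := by
    simp only [Matrix.add_apply, mul_add, Finset.sum_add_distrib]
    ring
  map_smul' c X := by
    simp only [Matrix.smul_apply, smul_eq_mul, RingHom.id_apply, mul_sub, Finset.mul_sum]
    congr 1
    · exact Finset.sum_congr rfl fun i _ => by ring
    · exact Finset.sum_congr rfl fun i _ => Finset.sum_congr rfl fun j _ => by ring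

theorem functional_vertex (a : Fin n → ℝ) (b : Fin n → Bool) :
    functional a (vertex b) = 1 - (1 - ∑ i, a i * if b i then 1 else 0) ^ 2 := by
  have h₁ : ∑ i, a i * vertex b i i = ∑ i, a i * if b i then 1 else 0 :=
    Finset.sum_congr rfl fun i _ => by by_cases h : b i <;> simp [vertex, h]
  have h₂ : ∑ i, ∑ j, a i * a j * vertex b i j = (∑ i, a i * if b i then 1 else 0) ^ 2 := by
    rw [sq, Finset.sum_mul_sum]
    refine Finset.sum_congr rfl fun i _ => Finset.sum_congr rfl fun j _ => ?_
    rw [vertex, Matrix.of_apply]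
    ring
  change 2 * ∑ i, a i * vertex b i i - ∑ i, ∑ j, a i * a j * vertex b i j = _
  rw [h₁, h₂]
  ring

theorem functional_le_one (a : Fin n → ℝ) {X : Matrix (Fin n) (Fin n) ℝ} (hX : X ∈ COR n) :
    functional a X ≤ 1 := by
  refine convexHull_min (t := {X | functional a X ≤ 1}) ?_
    (convex_halfSpace_le (functional a).isLinear 1) hX
  rintro _ ⟨b, rfl⟩
  change functional a (vertex b) ≤ 1
  rw [functional_vertex]
  linarith [sq_nonneg (1 - ∑ i, a i * if b i then (1 : ℝ) else 0)]

/-- The positions of the letter `x` in a word. -/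
def support (x : Fin 3) (w : Fin n → Fin 3) : Fin n → Bool := fun i => decide (w i = x)

theorem functional_word (v w : Fin n → Fin 3) :
    functional (fun i => if v i = 1 then 1 else 0) (vertex (support 2 w)) =
      1 - (1 - (TernaryWord.meet v w : ℝ)) ^ 2 := by
  rw [functional_vertex, TernaryWord.meet]
  push_cast
  congr 3
  refine Finset.sum_congr rfl fun i _ => ?_
  by_cases h₁ : v i = 1 <;> by_cases h₂ : w i = 2 <;> simp [support, h₁, h₂]

end COR

namespace TernaryWord

/-- The words `w` for which some vector in the kernel of all `Y v` with `meet w v = 1` lies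
outside the kernel of `Y w`. -/
noncomputable def separated {n d : ℕ} (Y : (Fin n → Fin 3) → Matrix (Fin d) (Fin d) ℝ) :
    Finset (Fin n → Fin 3) :=
  open scoped Classical in Finset.univ.filter fun w =>
    ∃ x, (∀ v, meet w v = 1 → (Y v).mulVec x = 0) ∧ (Y w).mulVec x ≠ 0

theorem mem_separated {n d : ℕ} {Y : (Fin n → Fin 3) → Matrix (Fin d) (Fin d) ℝ}
    {w : Fin n → Fin 3} : w ∈ separated Y ↔
      ∃ x, (∀ v, meet w v = 1 → (Y v).mulVec x = 0) ∧ (Y w).mulVec x ≠ 0 := by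
  simp [separated]

open Module in
theorem exists_finrank_add_length_le {n d : ℕ} (Y : (Fin n → Fin 3) → Matrix (Fin d) (Fin d) ℝ)
    (l : List (Fin n → Fin 3)) (hl : IsChain l) (hY : ∀ w ∈ l, w ∈ separated Y) :
    ∃ K : Submodule ℝ (Fin d → ℝ), (∀ x, (∀ w ∈ l, (Y w).mulVec x = 0) → x ∈ K) ∧
      finrank ℝ K + l.length ≤ d := by
  induction l with
  | nil => exact ⟨⊤, by simp⟩
  | cons w l ih =>
    obtain ⟨hw, hl'⟩ := List.pairwise_cons.1 hl
    obtain ⟨K, hK, hlen⟩ := ih hl' fun v hv => hY v (List.mem_cons_of_mem _ hv)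
    obtain ⟨x, hx, hxw⟩ := mem_separated.1 (hY w List.mem_cons_self)
    refine ⟨K ⊓ LinearMap.ker (Y w).mulVecLin, fun y hy => ⟨hK y fun v hv => ?_, ?_⟩, ?_⟩
    · exact hy v (List.mem_cons_of_mem _ hv)
    · simpa using hy w List.mem_cons_self
    · have hlt : K ⊓ LinearMap.ker (Y w).mulVecLin < K := by
        refine inf_le_left.lt_of_ne fun h => hxw ?_
        have hxK : x ∈ K := hK x fun v hv => hx v (hw v hv)
        rw [← h] at hxK
        simpa using hxK.2
      have := Submodule.finrank_lt_finrank_of_lt hlt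
      simp only [List.length_cons]
      omega

theorem card_separated_le {n d : ℕ} (Y : (Fin n → Fin 3) → Matrix (Fin d) (Fin d) ℝ) :
    (separated Y).card ≤ boundCount d n := by
  refine card_le_boundCount n d _ fun l hl hlS => ?_
  obtain ⟨K, -, h⟩ := exists_finrank_add_length_le Y l hl hlS
  omega

end TernaryWord

open TernaryWord in
/-- In a psd product lift of `COR n`, preimages of the vertices separate every word
in some factor. -/
theorem HasPsdProductLift.exists_separated {n d r : ℕ} (hn : 1 ≤ n)
    (h : HasPsdProductLift n d r (COR n)) :
    ∃ Y : Fin r → (Fin n → Fin 3) → Matrix (Fin d) (Fin d) ℝ,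
      ∀ w, ∃ i, w ∈ separated (Y i) := by
  obtain ⟨L, π, hπ⟩ := h
  have hsub {X : Fin r → Matrix (Fin d) (Fin d) ℝ} (hX : ∀ i, (X i).PosSemidef) (hXL : X ∈ L)
      (a : Fin n → ℝ) : COR.functional a (π X) ≤ 1 :=
    COR.functional_le_one a (hπ ▸ ⟨X, ⟨hX, hXL⟩, rfl⟩)
  have hex (w : Fin n → Fin 3) : ∃ X : Fin r → Matrix (Fin d) (Fin d) ℝ,
      (∀ i, (X i).PosSemidef) ∧ X ∈ L ∧ π X = COR.vertex (COR.support 2 w) := by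
    have hw := COR.vertex_mem (COR.support 2 w)
    rw [hπ] at hw
    obtain ⟨X, ⟨hX, hXL⟩, hXw⟩ := hw
    exact ⟨X, hX, hXL, hXw⟩
  choose Y hY hYL hYπ using hex
  have hval (v w : Fin n → Fin 3) :
      COR.functional (fun i => if v i = 1 then 1 else 0) (π (Y w)) =
        1 - (1 - (meet v w : ℝ)) ^ 2 := by
    rw [hYπ, COR.functional_word]
  refine ⟨fun i w => Y w i, fun w => ?_⟩
  by_contra! hw
  have hker (i : Fin r) (x : Fin d → ℝ) (hx : ∀ v, meet w v = 1 → (Y v i).mulVec x = 0) :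
      (Y w i).mulVec x = 0 := by
    by_contra hne
    exact hw i (mem_separated.2 ⟨x, hx, hne⟩)
  set V : Finset (Fin n → Fin 3) := Finset.univ.filter fun v => meet w v = 1 with hV
  rcases V.eq_empty_or_nonempty with hempty | hne
  · have hzero : Y w = 0 := by
      funext i
      ext j k
      have := hker i (Pi.single k 1) fun v hv =>
        absurd (show v ∈ V by simp [hV, hv]) (by simp [hempty])
      simpa using congrFun this j
    let u : Fin n → Fin 3 := Function.update 0 ⟨0, hn⟩ 1
    let v : Fin n → Fin 3 := Function.update 0 ⟨0, hn⟩ 2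
    have huv : meet u v = 1 := by
      rw [meet, Finset.sum_eq_single ⟨0, hn⟩]
      · simp [u, v]
      · intro i _ hi
        simp [u, hi]
      · simp
    have h2 : (2 : ℝ) • Y v ∈ L := by
      have := AffineMap.lineMap_mem (2 : ℝ) (hYL w) (hYL v)
      simpa [AffineMap.lineMap_apply, hzero] using this
    have := hsub (fun i => (hY v i).smul (by norm_num : (0 : ℝ) ≤ 2)) h2
      fun i => if u i = 1 then 1 else 0
    change COR.functional _ (π ((2 : ℝ) • Y v)) ≤ 1 at this
    rw [map_smul, map_smul, hval, huv] at this
    norm_num at this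
  · have hcard : (0 : ℝ) < V.card := by exact_mod_cast hne.card_pos
    set Z : Fin r → Matrix (Fin d) (Fin d) ℝ := ∑ v ∈ V, (V.card : ℝ)⁻¹ • Y v with hZ
    have hZL : Z ∈ L := L.convex.sum_mem (fun _ _ => by positivity)
      (by simp [hcard.ne']) fun v _ => hYL v
    have hZi (i : Fin r) : Z i = ∑ v ∈ V, (V.card : ℝ)⁻¹ • Y v i := by
      simp [hZ]
    have hterm (i : Fin r) (v : Fin n → Fin 3) : ((V.card : ℝ)⁻¹ • Y v i).PosSemidef :=
      (hY v i).smul (by positivity)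
    have hZpsd (i : Fin r) : (Z i).PosSemidef := by
      rw [hZi]
      exact Matrix.posSemidef_sum _ fun v _ => hterm i v
    have hZπ : COR.functional (fun i => if w i = 1 then 1 else 0) (π Z) = 1 := by
      rw [hZ, map_sum, map_sum, Finset.sum_congr rfl fun v hv => ?_, Finset.sum_const,
        nsmul_eq_mul, mul_inv_cancel₀ hcard.ne']
      rw [map_smul, map_smul, hval, (Finset.mem_filter.1 hv).2]
      simp
    have hev : ∀ᶠ ε : ℝ in nhdsWithin 0 (Set.Ioi 0), ∀ i, (Z i - ε • Y w i).PosSemidef := by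
      refine Filter.eventually_all.2 fun i => (hY w i).eventually_sub_smul (hZpsd i) fun x hx => ?_
      refine hker i x fun v hv => ?_
      rw [hZi] at hx
      have := Matrix.PosSemidef.mulVec_eq_zero_of_sum (hterm i) hx
        (Finset.mem_filter.2 ⟨Finset.mem_univ v, hv⟩)
      rw [Matrix.smul_mulVec] at this
      exact (smul_eq_zero.1 this).resolve_left (by positivity)
    obtain ⟨ε, hε, hε₀⟩ := (hev.and self_mem_nhdsWithin).exists
    have hX : Z + ε • (Z - Y w) ∈ L := by
      have := AffineMap.lineMap_mem (1 + ε) (hYL w) hZL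
      rw [AffineMap.lineMap_apply] at this
      convert! this using 1
      simp only [vsub_eq_sub, vadd_eq_add]
      module
    have hXpsd (i : Fin r) : ((Z + ε • (Z - Y w)) i).PosSemidef := by
      have : (Z + ε • (Z - Y w)) i = (Z i - ε • Y w i) + ε • Z i := by
        simp only [Pi.add_apply, Pi.smul_apply, Pi.sub_apply]
        module
      rw [this]
      exact (hε i).add ((hZpsd i).smul hε₀.le)
    have := hsub hXpsd hX fun i => if w i = 1 then 1 else 0
    rw [map_add, map_add, map_smul, map_smul, map_sub, map_sub, hZπ, hval, meet_self] at this
    norm_num at this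
    linarith

/-- **Main theorem.** For fixed `d ≥ 1` and `n ≥ d`, if `COR(n)` has a `(S^d_+)^r`-lift
then `r ≥ κ(d) ⬝ c(d)^n` where `c(d) = (1 - 1/3^d)^{-1/d}` and `κ(d) = (3^d - 1)^{-(1-1/d)}`. -/
theorem cor_psd_product_lift_lower_bound (d : ℕ) (hd : 1 ≤ d) (n : ℕ) (hn : d ≤ n)
    (r : ℕ) (hlift : HasPsdProductLift n d r (COR n)) :
    Real.rpow ((3 : ℝ) ^ d - 1) (-(1 - 1 / (d : ℝ))) *
      (Real.rpow (1 - 1 / (3 : ℝ) ^ d) (-(1 / (d : ℝ)))) ^ n ≤ (r : ℝ) := by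
  obtain ⟨Y, hY⟩ := hlift.exists_separated (hd.trans hn)
  have hcount : 3 ^ n ≤ r * TernaryWord.boundCount d n := by
    calc 3 ^ n = (Finset.univ : Finset (Fin n → Fin 3)).card := by simp
      _ ≤ (Finset.univ.biUnion fun i => TernaryWord.separated (Y i)).card :=
        Finset.card_le_card fun w _ => by simpa using hY w
      _ ≤ ∑ i, (TernaryWord.separated (Y i)).card := Finset.card_biUnion_le
      _ ≤ ∑ _i : Fin r, TernaryWord.boundCount d n :=
        Finset.sum_le_sum fun i _ => TernaryWord.card_separated_le (Y i)
      _ = r * TernaryWord.boundCount d n := by simp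
  have hd₀ : (d : ℝ) ≠ 0 := by positivity
  have h3 : (3 : ℝ) ≤ 3 ^ d := by
    simpa using pow_le_pow_right₀ (by norm_num : (1 : ℝ) ≤ 3) hd
  have hM : (0 : ℝ) < 3 ^ d - 1 := by linarith
  set m : ℝ := ((3 : ℝ) ^ d - 1) ^ (1 / (d : ℝ)) with hm
  have hm₀ : 0 < m := Real.rpow_pos_of_pos hM _
  have hκ : Real.rpow ((3 : ℝ) ^ d - 1) (-(1 - 1 / (d : ℝ))) = (m ^ (d - 1))⁻¹ := by
    rw [Real.rpow_eq_pow, Real.rpow_neg hM.le, ← Real.rpow_natCast m, hm, ← Real.rpow_mul hM.le,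
      Nat.cast_sub hd]
    congr 2
    field_simp
    simp
  have hc : Real.rpow (1 - 1 / (3 : ℝ) ^ d) (-(1 / (d : ℝ))) = 3 / m := by
    have : 1 - 1 / (3 : ℝ) ^ d = (3 ^ d - 1) / 3 ^ d := by field_simp
    rw [Real.rpow_eq_pow, this, Real.rpow_neg (by positivity), Real.div_rpow hM.le (by positivity),
      ← hm, inv_div, one_div, Real.pow_rpow_inv_natCast (by norm_num) (by omega)]
  have hreal : (3 : ℝ) ^ n ≤ r * m ^ (n + (d - 1)) :=
    calc (3 : ℝ) ^ n ≤ r * TernaryWord.boundCount d n := by exact_mod_cast hcount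
      _ ≤ r * m ^ (n + (d - 1)) := by
        gcongr
        exact TernaryWord.boundCount_le_rpow hd n
  rw [hκ, hc, div_pow, ← one_div, div_mul_div_comm, one_mul, div_le_iff₀ (by positivity),
    ← pow_add, add_comm]
  exact hreal
end

section
/- Let n ≥ 2. If the correlation polytope COR(n) admits a (S^2_+)^r-lift for some r ∈ ℕ, then r ≥ (1/√7)·(√(9/7))^n. -/
open scoped Matrix

namespace CorLift

/-- The size of the intersection of two subsets of `Fin n` given by their indicators. -/
def inter {n : ℕ} (a b : Fin n → Bool) : ℕ := ∑ i, if a i && b i then 1 else 0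

lemma inter_cons {n : ℕ} (x y : Bool) (a b : Fin n → Bool) :
    inter (Fin.cons x a : Fin (n + 1) → Bool) (Fin.cons y b : Fin (n + 1) → Bool) =
      (if x && y then 1 else 0) + inter a b := by
  simp only [inter, Fin.sum_univ_succ, Fin.cons_zero, Fin.cons_succ]

lemma sum_bool_fun_succ {n : ℕ} (F : (Fin (n + 1) → Bool) → ℕ) :
    ∑ a, F a = ∑ a : Fin n → Bool,
      (F (Fin.cons true a : Fin (n + 1) → Bool) + F (Fin.cons false a : Fin (n + 1) → Bool)) := by
  rw [← (Fin.consEquiv fun _ : Fin (n + 1) => Bool).sum_comp, Fintype.sum_prod_type,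
    Fintype.sum_bool, ← Finset.sum_add_distrib]
  rfl

lemma sum_disjoint (n : ℕ) :
    ∑ a : Fin n → Bool, ∑ b : Fin n → Bool, (if inter a b = 0 then 1 else 0) = 3 ^ n := by
  induction n with
  | zero => simp [inter]
  | succ n ih =>
    rw [sum_bool_fun_succ, pow_succ, ← ih, Finset.sum_mul]
    refine Finset.sum_congr rfl fun a _ => ?_
    rw [sum_bool_fun_succ, sum_bool_fun_succ, ← Finset.sum_add_distrib, Finset.sum_mul]
    refine Finset.sum_congr rfl fun b _ => ?_
    simp only [inter_cons]
    by_cases h : inter a b = 0 <;> simp [h]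

open Classical in
/-- A rectangle without pairs meeting in exactly one point has at most `2 ^ n` disjoint pairs. -/
lemma sum_disjoint_rectangle_le {n : ℕ} (A B : (Fin n → Bool) → Prop)
    (h : ∀ a b, A a → B b → inter a b ≠ 1) :
    ∑ a, ∑ b, (if A a ∧ B b ∧ inter a b = 0 then 1 else 0) ≤ 2 ^ n := by
  induction n with
  | zero =>
    simp only [Finset.univ_unique, Finset.sum_singleton, pow_zero]
    split_ifs <;> simp
  | succ n ih =>
    let A' (x : Bool) (a : Fin n → Bool) : Prop := A (Fin.cons x a : Fin (n + 1) → Bool)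
    let B' (x : Bool) (b : Fin n → Bool) : Prop := B (Fin.cons x b : Fin (n + 1) → Bool)
    have hAB : ∀ x y a b, (x && y) = false → A' x a → B' y b → inter a b ≠ 1 := by
      intro x y a b hxy ha hb
      have := h _ _ ha hb
      rw [inter_cons, hxy] at this
      simpa using this
    have hTT : ∀ a b, A' true a → B' true b → inter a b ≠ 0 := by
      intro a b ha hb
      have := h _ _ ha hb
      rw [inter_cons] at this
      simpa using this
    have h1 := ih (fun a => A' true a ∨ A' false a) (B' false) (by
      rintro a b (ha | ha) hb
      · exact hAB _ _ _ _ rfl ha hb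
      · exact hAB _ _ _ _ rfl ha hb)
    have h2 := ih (A' false) (fun b => B' true b ∨ B' false b) (by
      rintro a b ha (hb | hb)
      · exact hAB _ _ _ _ rfl ha hb
      · exact hAB _ _ _ _ rfl ha hb)
    rw [pow_succ, mul_two]
    refine le_trans ?_ (add_le_add h1 h2)
    rw [sum_bool_fun_succ, ← Finset.sum_add_distrib]
    refine Finset.sum_le_sum fun a _ => ?_
    rw [sum_bool_fun_succ, sum_bool_fun_succ, ← Finset.sum_add_distrib, ← Finset.sum_add_distrib]
    refine Finset.sum_le_sum fun b _ => ?_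
    simp only [inter_cons]
    change (if A' true a ∧ B' true b ∧ _ then 1 else 0)
      + (if A' true a ∧ B' false b ∧ _ then 1 else 0)
      + ((if A' false a ∧ B' true b ∧ _ then 1 else 0)
      + (if A' false a ∧ B' false b ∧ _ then 1 else 0)) ≤ _
    by_cases h0 : inter a b = 0
    · have hnot : ¬(A' true a ∧ B' true b) := fun h => hTT a b h.1 h.2 h0
      by_cases p : A' true a <;> by_cases q : B' true b <;> by_cases u : A' false a <;>
        by_cases v : B' false b <;> simp only [p, q, and_self, not_true_eq_false] at hnot <;>
        simp [p, q, u, v, h0]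
    · simp [h0]

lemma four_mul_card_separating {Λ : Type*} [DecidableEq Λ] (L : Finset Λ) {x y : Λ}
    (hx : x ∈ L) (hy : y ∈ L) (hxy : x ≠ y) :
    4 * (L.powerset.filter fun S => x ∈ S ∧ y ∉ S).card = 2 ^ L.card := by
  have : (L.powerset.filter fun S => x ∈ S ∧ y ∉ S) = Finset.Icc {x} (L.erase y) := by
    ext S
    simp only [Finset.mem_filter, Finset.mem_powerset, Finset.mem_Icc,
      Finset.singleton_subset_iff, Finset.subset_erase]
    tauto
  have hsub : ({x} : Finset Λ) ⊆ L.erase y := by simp [hx, hxy]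
  have h2 : 2 ≤ L.card := by
    rw [← Finset.card_pair hxy]
    exact Finset.card_le_card (by simp [Finset.insert_subset_iff, hx, hy])
  rw [this, Finset.card_Icc_finset hsub, Finset.card_erase_of_mem hy, Finset.card_singleton]
  obtain ⟨k, hk⟩ := Nat.exists_eq_add_of_le h2
  rw [hk, show 2 + k - 1 - 1 = k by omega, pow_add]
  norm_num

open Classical in
/-- If rows and columns carry labels which agree whenever the sets meet in exactly one point, then
at most `4 * 2 ^ n` disjoint pairs have distinct labels. -/
lemma sum_disjoint_labels_le {n : ℕ} {Λ : Type*} (A B : (Fin n → Bool) → Prop)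
    (f g : (Fin n → Bool) → Λ) (h : ∀ a b, A a → B b → inter a b = 1 → f a = g b) :
    ∑ a, ∑ b, (if (A a ∧ B b ∧ f a ≠ g b) ∧ inter a b = 0 then 1 else 0) ≤ 4 * 2 ^ n := by
  set L : Finset Λ := Finset.univ.image f ∪ Finset.univ.image g with hL
  refine Nat.le_of_mul_le_mul_left (c := 2 ^ L.card) ?_ (by positivity)
  have hS : ∀ S ∈ L.powerset,
      ∑ a, ∑ b, (if (A a ∧ f a ∈ S) ∧ (B b ∧ g b ∉ S) ∧ inter a b = 0 then 1 else 0) ≤ 2 ^ n := by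
    intro S _
    refine le_trans (le_of_eq ?_)
      (sum_disjoint_rectangle_le (fun a => A a ∧ f a ∈ S) (fun b => B b ∧ g b ∉ S) ?_)
    · congr!
    rintro a b ⟨ha, haS⟩ ⟨hb, hbS⟩ hab
    exact hbS (h a b ha hb hab ▸ haS)
  have hsum := Finset.sum_le_sum hS
  rw [Finset.sum_const, Finset.card_powerset, smul_eq_mul] at hsum
  calc _ ≤ 4 * ∑ S ∈ L.powerset, ∑ a, ∑ b,
        (if (A a ∧ f a ∈ S) ∧ (B b ∧ g b ∉ S) ∧ inter a b = 0 then 1 else 0) := by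
        rw [Finset.sum_comm (s := L.powerset), Finset.mul_sum, Finset.mul_sum]
        refine Finset.sum_le_sum fun a _ => ?_
        rw [Finset.sum_comm (s := L.powerset), Finset.mul_sum, Finset.mul_sum]
        refine Finset.sum_le_sum fun b _ => ?_
        split_ifs with hc
        · obtain ⟨⟨ha, hb, hfg⟩, h0⟩ := hc
          rw [mul_one, ← four_mul_card_separating L (x := f a) (y := g b) (by simp [hL])
            (by simp [hL]) hfg, Finset.card_filter]
          simp [ha, hb, h0]
        · simp
    _ ≤ 4 * (2 ^ L.card * 2 ^ n) := by gcongr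
    _ = _ := by ring

lemma posSemidef_fin_two_iff (M : Matrix (Fin 2) (Fin 2) ℝ) :
    M.PosSemidef ↔ M 1 0 = M 0 1 ∧ 0 ≤ M 0 0 ∧ 0 ≤ M 1 1 ∧ 0 ≤ M 0 0 * M 1 1 - M 0 1 ^ 2 := by
  constructor
  · intro h
    have hs : M 1 0 = M 0 1 := by simpa using h.1.apply 0 1
    have hd := h.det_nonneg
    rw [Matrix.det_fin_two, hs] at hd
    exact ⟨hs, h.diag_nonneg, h.diag_nonneg, by linarith⟩
  · rintro ⟨hs, h0, h1, hd⟩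
    refine Matrix.PosSemidef.of_dotProduct_mulVec_nonneg ?_ fun x => ?_
    · ext i j
      fin_cases i <;> fin_cases j <;> simp [hs]
    · simp only [star_trivial, dotProduct, Matrix.mulVec, Fin.sum_univ_two, hs]
      rcases h0.eq_or_lt with h | h
      · have : M 0 1 = 0 := by
          rw [← h] at hd
          nlinarith [sq_nonneg (M 0 1)]
        rw [this, ← h]
        nlinarith [mul_nonneg h1 (sq_nonneg (x 1))]
      · refine nonneg_of_mul_nonneg_right (a := M 0 0) ?_ h
        nlinarith [sq_nonneg (M 0 0 * x 0 + M 0 1 * x 1), mul_nonneg hd (sq_nonneg (x 1))]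

open Filter Topology in
lemma eventually_posSemidef_sub_smul {Z X : Matrix (Fin 2) (Fin 2) ℝ} (hZ : Z.PosSemidef)
    (hX : X.PosSemidef) (hker : LinearMap.ker Z.mulVecLin ≤ LinearMap.ker X.mulVecLin) :
    ∀ᶠ ε : ℝ in 𝓝[>] 0, (Z - ε • X).PosSemidef := by
  suffices h : ∃ δ : ℝ, 0 < δ ∧ (Z - δ • X).PosSemidef by
    obtain ⟨δ, hδ, h⟩ := h
    filter_upwards [Ioo_mem_nhdsGT hδ] with ε hε
    have : Z - ε • X = (Z - δ • X) + (δ - ε) • X := by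
      rw [sub_smul]; abel
    rw [this]
    exact h.add (hX.smul (sub_nonneg.2 hε.2.le))
  obtain ⟨hXs, hX0, hX1, hXd⟩ := (posSemidef_fin_two_iff X).1 hX
  obtain ⟨hZs, hZ0, hZ1, hZd⟩ := (posSemidef_fin_two_iff Z).1 hZ
  rcases hZd.eq_or_lt with hd | hd
  · have key : ∀ u v : ℝ, Z 0 0 * u + Z 0 1 * v = 0 → Z 0 1 * u + Z 1 1 * v = 0 →
        X 0 0 * u + X 0 1 * v = 0 ∧ X 0 1 * u + X 1 1 * v = 0 := by
      intro u v h0 h1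
      have := @hker ![u, v] (by
        rw [LinearMap.mem_ker]
        ext i
        fin_cases i <;> simp [Matrix.mulVec, dotProduct, Fin.sum_univ_two, hZs, h0, h1])
      rw [LinearMap.mem_ker] at this
      have e0 := congrFun this 0
      have e1 := congrFun this 1
      simp [Matrix.mulVec, dotProduct, Fin.sum_univ_two, hXs] at e0 e1
      exact ⟨e0, e1⟩
    obtain ⟨a1, a2⟩ := key (Z 0 1) (-Z 0 0) (by ring) (by linarith)
    obtain ⟨b1, b2⟩ := key (Z 1 1) (-Z 0 1) (by linarith) (by ring)
    by_cases hT : Z 0 0 + Z 1 1 = 0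
    · have z0 : Z 0 0 = 0 := by linarith
      have z1 : Z 1 1 = 0 := by linarith
      have z2 : Z 0 1 = 0 := by rw [z0] at hd; nlinarith [sq_nonneg (Z 0 1)]
      obtain ⟨c1, c2⟩ := key 1 0 (by simp [z0]) (by simp [z2])
      obtain ⟨d1, d2⟩ := key 0 1 (by simp [z2]) (by simp [z1])
      refine ⟨1, one_pos, ?_⟩
      rw [posSemidef_fin_two_iff]
      simp at c1 c2 d1 d2
      simp [c1, c2, d2, hXs, z0, z1, z2, hZs]
    · have hTpos : 0 < Z 0 0 + Z 1 1 := lt_of_le_of_ne (by positivity) (Ne.symm hT)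
      have hX' : X = ((X 0 0 + X 1 1) / (Z 0 0 + Z 1 1)) • Z := by
        ext i j
        fin_cases i <;> fin_cases j <;>
          simp only [Fin.zero_eta, Fin.mk_one, Matrix.smul_apply, smul_eq_mul] <;> field_simp <;>
          nlinarith
      set t := (X 0 0 + X 1 1) / (Z 0 0 + Z 1 1) with ht
      have ht0 : 0 ≤ t := by positivity
      refine ⟨1 / (1 + t), by positivity, ?_⟩
      rw [hX', smul_smul]
      have : Z - (1 / (1 + t) * t) • Z = (1 / (1 + t)) • Z := by
        nth_rewrite 1 [← one_smul ℝ Z]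
        rw [← sub_smul]
        congr 1
        field_simp
        ring
      rw [this]
      exact hZ.smul (by positivity)
  · have p0 : 0 < Z 0 0 := lt_of_le_of_ne hZ0 fun h => by
      rw [← h] at hd; nlinarith [sq_nonneg (Z 0 1)]
    have p1 : 0 < Z 1 1 := lt_of_le_of_ne hZ1 fun h => by
      rw [← h] at hd; nlinarith [sq_nonneg (Z 0 1)]
    have e : ∀ F : ℝ → ℝ, Continuous F → 0 < F 0 → ∀ᶠ ε : ℝ in 𝓝[>] 0, 0 < F ε := fun F hF h =>
      (hF.continuousAt.eventually (lt_mem_nhds h)).filter_mono nhdsWithin_le_nhds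
    have e0 := e (fun ε => Z 0 0 - ε * X 0 0) (by fun_prop) (by simpa)
    have e1 := e (fun ε => Z 1 1 - ε * X 1 1) (by fun_prop) (by simpa)
    have e2 := e (fun ε => (Z 0 0 - ε * X 0 0) * (Z 1 1 - ε * X 1 1) - (Z 0 1 - ε * X 0 1) ^ 2)
      (by fun_prop) (by simpa using hd)
    obtain ⟨ε, h0, h1, h2, hε⟩ := (e0.and (e1.and (e2.and self_mem_nhdsWithin))).exists
    refine ⟨ε, hε, ?_⟩
    rw [posSemidef_fin_two_iff]
    simp only [Matrix.sub_apply, Matrix.smul_apply, smul_eq_mul]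
    exact ⟨by rw [hZs, hXs], h0.le, h1.le, h2.le⟩

/-- In dimension two, an inclusion of a nonzero subspace in a proper one is an equality. -/
lemma submodule_eq_of_le {U V : Submodule ℝ (Fin 2 → ℝ)} (h : U ≤ V) (hU : U ≠ ⊥)
    (hV : V ≠ ⊤) : U = V := by
  refine Submodule.eq_of_le_of_finrank_le h ?_
  have h1 := Submodule.finrank_lt (lt_top_iff_ne_top.2 hV).ne
  have h2 := Submodule.one_le_finrank_iff.2 hU
  simp at h1
  omega

lemma ker_sum_le {ι : Type*} (s : Finset ι) (X : ι → Matrix (Fin 2) (Fin 2) ℝ)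
    (hX : ∀ b ∈ s, (X b).PosSemidef) {b : ι} (hb : b ∈ s) :
    LinearMap.ker (∑ c ∈ s, X c).mulVecLin ≤ LinearMap.ker (X b).mulVecLin := by
  intro v hv
  rw [LinearMap.mem_ker, Matrix.mulVecLin_apply] at hv ⊢
  have h0 : ∑ c ∈ s, star v ⬝ᵥ (X c *ᵥ v) = 0 := by
    rw [← dotProduct_sum, ← Matrix.sum_mulVec, hv, dotProduct_zero]
  rw [Finset.sum_eq_zero_iff_of_nonneg fun c hc => (hX c hc).dotProduct_mulVec_nonneg v] at h0
  exact ((hX b hb).dotProduct_mulVec_zero_iff v).1 (h0 b hb)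

/-- The rank-one vertex `bbᵀ` of the correlation polytope. -/
def vertex {n : ℕ} (b : Fin n → Bool) : Matrix (Fin n) (Fin n) ℝ :=
  Matrix.of fun i j => (if b i then (1 : ℝ) else 0) * (if b j then (1 : ℝ) else 0)

/-- The linear form taking the value `|a ∩ b|² - 2 |a ∩ b|` at `bbᵀ`. -/
def form {n : ℕ} (a : Fin n → Bool) : Matrix (Fin n) (Fin n) ℝ →ₗ[ℝ] ℝ where
  toFun Y := ∑ i, ∑ j, (if a i then (1 : ℝ) else 0) * (if a j then (1 : ℝ) else 0) * Y i j
    - 2 * ∑ i, (if a i then (1 : ℝ) else 0) * Y i i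
  map_add' Y W := by
    simp only [Matrix.add_apply, mul_add, Finset.sum_add_distrib]
    ring
  map_smul' c Y := by
    simp only [Matrix.smul_apply, smul_eq_mul, RingHom.id_apply, mul_sub, Finset.mul_sum]
    congr 1
    · exact Finset.sum_congr rfl fun i _ => Finset.sum_congr rfl fun j _ => by ring
    · exact Finset.sum_congr rfl fun i _ => by ring

lemma form_vertex {n : ℕ} (a b : Fin n → Bool) :
    form a (vertex b) = (inter a b : ℝ) ^ 2 - 2 * inter a b := by
  have h : (inter a b : ℝ) =
      ∑ i, (if a i then (1 : ℝ) else 0) * (if b i then (1 : ℝ) else 0) := by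
    simp only [inter, Nat.cast_sum]
    refine Finset.sum_congr rfl fun i _ => ?_
    cases a i <;> cases b i <;> simp
  simp only [form, vertex, LinearMap.coe_mk, AddHom.coe_mk, Matrix.of_apply]
  congr 1
  · rw [h, sq, Finset.sum_mul_sum]
    exact Finset.sum_congr rfl fun i _ => Finset.sum_congr rfl fun j _ => by ring
  · rw [h]
    congr 1
    refine Finset.sum_congr rfl fun i _ => ?_
    cases a i <;> cases b i <;> simp

lemma vertex_mem_COR {n : ℕ} (b : Fin n → Bool) : vertex b ∈ COR n :=
  subset_convexHull _ _ ⟨b, rfl⟩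

lemma neg_one_le_form {n : ℕ} (a : Fin n → Bool) {Y : Matrix (Fin n) (Fin n) ℝ}
    (hY : Y ∈ COR n) : -1 ≤ form a Y := by
  have hc : Convex ℝ {Y : Matrix (Fin n) (Fin n) ℝ | -1 ≤ form a Y} :=
    convex_halfSpace_ge (form a).isLinear _
  refine convexHull_min ?_ hc hY
  rintro _ ⟨b, rfl⟩
  change -1 ≤ form a (vertex b)
  rw [form_vertex]
  nlinarith [sq_nonneg ((inter a b : ℝ) - 1)]

lemma vertex_eq_zero {n : ℕ} {b : Fin n → Bool} (h : vertex b = 0) : b = fun _ => false := by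
  funext i
  have := congrFun (congrFun h i) i
  by_contra hb
  simp [vertex, hb] at this

open Filter Topology in
/-- In a lift of `COR n`, every disjoint pair other than `(∅, ∅)` is witnessed by some block. -/
lemma exists_block {n r : ℕ} {L : AffineSubspace ℝ (Fin r → Matrix (Fin 2) (Fin 2) ℝ)}
    {π : (Fin r → Matrix (Fin 2) (Fin 2) ℝ) →ₗ[ℝ] Matrix (Fin n) (Fin n) ℝ}
    (hL : ∀ X ∈ L, (∀ i, (X i).PosSemidef) → π X ∈ COR n)
    {X : (Fin n → Bool) → Fin r → Matrix (Fin 2) (Fin 2) ℝ}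
    (hpsd : ∀ b i, (X b i).PosSemidef) (hXL : ∀ b, X b ∈ L) (hπ : ∀ b, π (X b) = vertex b)
    {a b : Fin n → Bool} (hab : inter a b = 0)
    (hne : ¬(a = (fun _ => false) ∧ b = fun _ => false)) :
    ∃ i, ¬ LinearMap.ker (∑ c with inter a c = 1, X c i).mulVecLin ≤
      LinearMap.ker (X b i).mulVecLin := by
  by_contra! hker
  set s : Finset (Fin n → Bool) := Finset.univ.filter fun c => inter a c = 1 with hs
  by_cases ha : a = fun _ => false
  · have hs0 : s = ∅ := by simp [hs, ha, inter]
    have : X b = 0 := by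
      funext i
      have hi := hker i
      rw [hs0, Finset.sum_empty, Matrix.mulVecLin_zero, LinearMap.ker_zero, top_le_iff,
        LinearMap.ker_eq_top] at hi
      exact Matrix.toLin'.injective (by simpa [Matrix.toLin'_apply'] using hi)
    refine hne ⟨ha, vertex_eq_zero ?_⟩
    rw [← hπ, this, map_zero]
  · obtain ⟨k, hk⟩ : ∃ k, a k = true := by
      by_contra! h
      exact ha (funext fun k => by simpa using h k)
    have hsn : s.Nonempty := by
      refine ⟨fun j => decide (j = k), ?_⟩
      rw [hs, Finset.mem_filter]
      refine ⟨Finset.mem_univ _, ?_⟩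
      rw [inter, Finset.sum_eq_single k] <;> simp +contextual [hk]
    have hm : (0 : ℝ) < s.card := by exact_mod_cast hsn.card_pos
    have hev : ∀ᶠ ε : ℝ in 𝓝[>] 0, ∀ i, ((∑ c ∈ s, X c i) - ε • X b i).PosSemidef :=
      eventually_all.2 fun i => eventually_posSemidef_sub_smul
        (Matrix.posSemidef_sum s fun c _ => hpsd c i) (hpsd b i) (hker i)
    obtain ⟨ε, hε, hε0, hεm⟩ := (hev.and (Ioo_mem_nhdsGT hm)).exists
    have hd : 0 < (s.card : ℝ) - ε := sub_pos.2 hεm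
    set W : Fin r → Matrix (Fin 2) (Fin 2) ℝ :=
      ((s.card : ℝ) - ε)⁻¹ • (∑ c ∈ s, X c - ε • X b) with hW
    have hWp : ∀ i, (W i).PosSemidef := by
      intro i
      have := (hε i).smul (inv_nonneg.2 hd.le)
      simpa [hW, Finset.sum_apply] using this
    have hZ : (s.card : ℝ)⁻¹ • ∑ c ∈ s, X c ∈ L := by
      rw [Finset.smul_sum]
      refine L.convex.sum_mem (fun _ _ => by positivity) ?_ fun c _ => hXL c
      rw [Finset.sum_const, nsmul_eq_mul, mul_inv_cancel₀ hm.ne']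
    have hWL : W ∈ L := by
      have := AffineMap.lineMap_mem (((s.card : ℝ) - ε)⁻¹ * s.card) (hXL b) hZ
      convert this using 1
      rw [AffineMap.lineMap_apply_module, smul_smul, hW, smul_sub, smul_smul, mul_assoc,
        mul_inv_cancel₀ hm.ne', mul_one, sub_eq_add_neg, add_comm, ← neg_smul]
      congr 2
      field_simp
      ring
    have hval := neg_one_le_form a (hL W hWL hWp)
    have hsum : ∑ c ∈ s, form a (π (X c)) = -s.card := by
      have : ∀ c ∈ s, form a (π (X c)) = -1 := by
        intro c hc
        have hc' : inter a c = 1 := by simpa [hs] using hc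
        rw [hπ, form_vertex, hc']
        norm_num
      rw [Finset.sum_congr rfl this]
      simp
    rw [hW, map_smul, map_smul, map_sub, map_sub, map_sum, map_sum, hsum, map_smul, map_smul, hπ b,
      form_vertex, hab, smul_eq_mul, inv_mul_eq_div, le_div_iff₀ hd] at hval
    simp at hval
    linarith

lemma bound_le {n r : ℕ} (hn : 2 ≤ n) (h : 3 ^ n ≤ r * (4 * 2 ^ n) + 1) :
    (1 / Real.sqrt 7) * (Real.sqrt (9 / 7)) ^ n ≤ (r : ℝ) := by
  obtain ⟨k, rfl⟩ := Nat.exists_eq_add_of_le' hn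
  have h' : (3 : ℝ) ^ (k + 2) ≤ r * (4 * 2 ^ (k + 2)) + 1 := by exact_mod_cast h
  have h7 : 1 / Real.sqrt 7 ≤ 7 / 18 := by
    rw [div_le_div_iff₀ (by positivity) (by norm_num)]
    have : (18 / 7 : ℝ) ≤ Real.sqrt 7 := Real.le_sqrt_of_sq_le (by norm_num)
    linarith
  have ht : Real.sqrt (9 / 7) ≤ 3 / 2 := Real.sqrt_le_iff.2 (by norm_num)
  have hp : Real.sqrt (9 / 7) ^ (k + 2) ≤ (3 / 2) ^ k * (9 / 7) := by
    rw [pow_add, Real.sq_sqrt (by norm_num)]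
    gcongr
  have h3 : (1 : ℝ) ≤ 3 ^ k := one_le_pow₀ (by norm_num)
  calc _ ≤ (7 / 18 : ℝ) * ((3 / 2) ^ k * (9 / 7)) := by gcongr
    _ = (3 ^ k / 2 ^ k) / 2 := by rw [div_pow]; ring
    _ ≤ r := by
      rw [div_div, div_le_iff₀ (by positivity)]
      rw [pow_add, pow_add] at h'
      linarith

end CorLift

open CorLift in
/-- For `n ≥ 2`, if `COR(n)` has a `(S^2_+)^r`-lift then `r ≥ (1/√7)·(√(9/7))^n`. -/
theorem cor_soc_lift_lower_bound (n : ℕ) (hn : 2 ≤ n)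
    (r : ℕ) (hlift : HasPsdProductLift n 2 r (COR n)) :
    (1 / Real.sqrt 7) * (Real.sqrt (9 / 7)) ^ n ≤ (r : ℝ) := by
  classical
  obtain ⟨L, π, hP⟩ := hlift
  have hL : ∀ X ∈ L, (∀ i, (X i).PosSemidef) → π X ∈ COR n := fun X hX hX' =>
    hP ▸ ⟨X, ⟨hX', hX⟩, rfl⟩
  have hex : ∀ b : Fin n → Bool, ∃ X : Fin r → Matrix (Fin 2) (Fin 2) ℝ,
      (∀ i, (X i).PosSemidef) ∧ X ∈ L ∧ π X = vertex b := by
    intro b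
    have hb := vertex_mem_COR b
    rw [hP] at hb
    obtain ⟨X, ⟨h1, h2⟩, h3⟩ := hb
    exact ⟨X, h1, h2, h3⟩
  choose X hpsd hXL hπ using hex
  let f (i : Fin r) (a : Fin n → Bool) : Submodule ℝ (Fin 2 → ℝ) :=
    LinearMap.ker (∑ c with inter a c = 1, X c i).mulVecLin
  let g (i : Fin r) (b : Fin n → Bool) : Submodule ℝ (Fin 2 → ℝ) :=
    LinearMap.ker (X b i).mulVecLin
  have hblock : ∀ i, ∑ a, ∑ b, (if (f i a ≠ ⊥ ∧ g i b ≠ ⊤ ∧ f i a ≠ g i b) ∧ inter a b = 0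
      then 1 else 0) ≤ 4 * 2 ^ n := fun i => by
    convert sum_disjoint_labels_le (fun a => f i a ≠ ⊥) (fun b => g i b ≠ ⊤) (f i) (g i)
      fun a b ha hb hab => submodule_eq_of_le
        (ker_sum_le _ (fun c => X c i) (fun c _ => hpsd c i) (by simpa using hab)) ha hb
  refine bound_le hn ?_
  have hsum := Finset.sum_le_sum fun i (_ : i ∈ Finset.univ) => hblock i
  rw [Finset.sum_const, Finset.card_univ, Fintype.card_fin, smul_eq_mul] at hsum
  have hone : ∑ a : Fin n → Bool, ∑ b : Fin n → Bool,
      (if a = (fun _ => false) ∧ b = (fun _ => false) then 1 else 0) = 1 := by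
    simp [ite_and]
  rw [← sum_disjoint]
  nth_rewrite 2 [← hone]
  refine le_trans ?_ (Nat.add_le_add_right hsum _)
  rw [Finset.sum_comm (s := (Finset.univ : Finset (Fin r))), ← Finset.sum_add_distrib]
  refine Finset.sum_le_sum fun a _ => ?_
  rw [Finset.sum_comm (s := (Finset.univ : Finset (Fin r))), ← Finset.sum_add_distrib]
  refine Finset.sum_le_sum fun b _ => ?_
  by_cases h0 : inter a b = 0
  · by_cases hne : a = (fun _ => false) ∧ b = fun _ => false
    · rw [if_pos h0, if_pos hne]
      exact le_add_self
    · obtain ⟨i, hi⟩ := exists_block hL hpsd hXL hπ h0 hne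
      have hi' : (f i a ≠ ⊥ ∧ g i b ≠ ⊤ ∧ f i a ≠ g i b) ∧ inter a b = 0 :=
        ⟨⟨fun h => hi (h.trans_le bot_le), fun h => hi (le_top.trans_eq h.symm),
          fun h => hi h.le⟩, h0⟩
      rw [if_pos h0]
      refine le_add_right ?_
      refine le_trans (by rw [if_pos hi']) (Finset.single_le_sum
        (f := fun i => if (f i a ≠ ⊥ ∧ g i b ≠ ⊤ ∧ f i a ≠ g i b) ∧ inter a b = 0
          then 1 else 0) (fun _ _ => Nat.zero_le _) (Finset.mem_univ i))
  · simp [h0]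
end

section
/- Let d ≥ 1 be fixed and let n ≥ d. Then rank_{S^d_+}(UDISJ(n)) ≥ 3^n / (3^d − 1)^{⌊(n−1)/d⌋ + 1}, and consequently rank_{S^d_+}(UDISJ(n)) ≥ (3^d − 1)^{−(1−1/d)} · ((1 − 3^{−d})^{−1/d})^n. -/
/-- Bit strings of length `n`. -/
abbrev BitStr (n : ℕ) : Type := Fin n → Bool

/-- The inner product `aᵀb = Σᵢ aᵢbᵢ` of two bit strings (a natural number;
its value over `ℝ` is obtained by coercion). -/
def bitIP {n : ℕ} (a b : BitStr n) : ℕ := ∑ i, if a i && b i then 1 else 0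

/-- The unique disjointness matrix `UDISJ(n)_{a,b} = (1 - aᵀb)²`. -/
noncomputable def UDISJ (n : ℕ) : Matrix (BitStr n) (BitStr n) ℝ :=
  Matrix.of fun a b => (1 - (bitIP a b : ℝ)) ^ 2

/-- `M` admits an `S^d_+`-factorization: `M a b = Tr(X_a Y_b)` for `d × d` real
positive semidefinite matrices `X_a` (one per row) and `Y_b` (one per column). -/
def HasPsdFactorization (d : ℕ) {n : ℕ} (M : Matrix (BitStr n) (BitStr n) ℝ) : Prop :=
  ∃ (X Y : BitStr n → Matrix (Fin d) (Fin d) ℝ),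
    (∀ a, (X a).PosSemidef) ∧ (∀ b, (Y b).PosSemidef) ∧
    ∀ a b, M a b = (X a * Y b).trace

open Finset in
/-- The ordered pairs of disjoint subsets of `S`. -/
def disjointPairs {ι : Type*} [DecidableEq ι] (S : Finset ι) : Finset (Finset ι × Finset ι) :=
  {p ∈ S.powerset ×ˢ S.powerset | Disjoint p.1 p.2}

section DisjointPairs

variable {ι : Type*} [DecidableEq ι]

theorem mem_disjointPairs {S : Finset ι} {p : Finset ι × Finset ι} :
    p ∈ disjointPairs S ↔ p.1 ⊆ S ∧ p.2 ⊆ S ∧ Disjoint p.1 p.2 := by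
  simp [disjointPairs, and_assoc]

theorem card_disjointPairs (S : Finset ι) : (disjointPairs S).card = 3 ^ S.card := by
  have h : disjointPairs S = (S.powerset.sigma fun a => (S \ a).powerset).map
      (Equiv.sigmaEquivProd _ _).toEmbedding := by
    ext ⟨a, b⟩
    simp only [mem_disjointPairs, Finset.mem_map_equiv, Finset.mem_sigma, Finset.mem_powerset,
      Equiv.sigmaEquivProd_symm_apply, Finset.subset_sdiff]
    exact and_congr_right fun _ => and_congr_right fun _ => disjoint_comm
  rw [h, Finset.card_map, Finset.card_sigma, show (3 : ℕ) = 1 + 2 from rfl,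
    ← Finset.sum_pow_mul_eq_add_pow]
  refine Finset.sum_congr rfl fun a ha => ?_
  rw [Finset.card_powerset, Finset.card_sdiff_of_subset (Finset.mem_powerset.mp ha), one_pow,
    one_mul]

end DisjointPairs

open Matrix in
theorem Matrix.trace_conjTranspose_mul_self_mul {m : Type*} [Fintype m] (B C : Matrix m m ℝ) :
    (Bᴴ * B * (Cᴴ * C)).trace = ((B * Cᴴ)ᴴ * (B * Cᴴ)).trace := by
  rw [← Matrix.mul_assoc, Matrix.trace_mul_comm, conjTranspose_mul, conjTranspose_conjTranspose]
  simp only [Matrix.mul_assoc]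

namespace Matrix.PosSemidef

open Matrix

variable {m : Type*} [Fintype m] [DecidableEq m] {X Y : Matrix m m ℝ}

open scoped MatrixOrder in
theorem exists_eq_conjTranspose_mul_self (hX : X.PosSemidef) : ∃ B : Matrix m m ℝ, X = Bᴴ * B :=
  CStarAlgebra.nonneg_iff_eq_star_mul_self.mp hX.nonneg

theorem trace_mul_nonneg (hX : X.PosSemidef) (hY : Y.PosSemidef) : 0 ≤ (X * Y).trace := by
  obtain ⟨B, rfl⟩ := hX.exists_eq_conjTranspose_mul_self
  obtain ⟨C, rfl⟩ := hY.exists_eq_conjTranspose_mul_self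
  rw [trace_conjTranspose_mul_self_mul]
  exact (posSemidef_conjTranspose_mul_self _).trace_nonneg

theorem mul_eq_zero_of_trace_mul_eq_zero (hX : X.PosSemidef) (hY : Y.PosSemidef)
    (h : (X * Y).trace = 0) : Y * X = 0 := by
  obtain ⟨B, rfl⟩ := hX.exists_eq_conjTranspose_mul_self
  obtain ⟨C, rfl⟩ := hY.exists_eq_conjTranspose_mul_self
  rw [trace_conjTranspose_mul_self_mul, trace_conjTranspose_mul_self_eq_zero_iff] at h
  have h' : C * Bᴴ = 0 := by
    rw [← conjTranspose_eq_zero, conjTranspose_mul, conjTranspose_conjTranspose, h]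
  rw [Matrix.mul_assoc, ← Matrix.mul_assoc C, h', Matrix.zero_mul, Matrix.mul_zero]

end Matrix.PosSemidef

section Count

open Finset Matrix

variable {ι : Type*} [DecidableEq ι] {d : ℕ}

/-- A family of positive semidefinite matrices indexed by subsets cannot be orthogonal on all
pairs meeting in one point while being non-orthogonal on all disjoint pairs of subsets of a
`d`-element set. -/
theorem exists_disjoint_trace_eq_zero {T : Finset ι} (hT : T.card = d)
    (X Y : Finset ι → Matrix (Fin d) (Fin d) ℝ)
    (hX : ∀ a, (X a).PosSemidef) (hY : ∀ a, (Y a).PosSemidef)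
    (h1 : ∀ a ⊆ T, ∀ b ⊆ T, (a ∩ b).card = 1 → (X a * Y b).trace = 0) :
    ∃ p ∈ disjointPairs T, (X p.1 * Y p.2).trace = 0 := by
  by_contra! hne
  let W : Finset ι → Submodule ℝ (Fin d → ℝ) := fun S =>
    ⨆ i ∈ S, LinearMap.range (X {i}).mulVecLin
  have hker : ∀ S ⊆ T, W S ≤ LinearMap.ker (Y S).mulVecLin := by
    intro S hS
    refine iSup₂_le fun i hi => ?_
    rw [LinearMap.range_le_ker_iff, ← Matrix.mulVecLin_mul,
      (hX _).mul_eq_zero_of_trace_mul_eq_zero (hY _)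
        (h1 {i} (by simpa using hS hi) S hS (by simp [hi])), Matrix.mulVecLin_zero]
  have hdim : ∀ S ⊆ T, S.card ≤ Module.finrank ℝ (W S) := by
    intro S
    induction S using Finset.induction_on with
    | empty => simp
    | insert j S hj ih =>
      intro hS
      obtain ⟨hjT, hST⟩ := Finset.insert_subset_iff.mp hS
      rw [card_insert_of_notMem hj]
      refine Nat.succ_le_of_lt ((ih hST).trans_lt (Submodule.finrank_lt_finrank_of_lt ?_))
      have hW : W (insert j S) = LinearMap.range (X {j}).mulVecLin ⊔ W S := by
        exact Finset.iSup_insert j S _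
      rw [hW, right_lt_sup]
      intro hle
      have h0 := LinearMap.range_le_ker_iff.mp (hle.trans (hker S hST))
      rw [← Matrix.mulVecLin_mul, ← Matrix.mulVecLin_zero] at h0
      refine hne ({j}, S) (mem_disjointPairs.mpr ⟨by simpa using hjT, hST, by simpa using hj⟩) ?_
      rw [Matrix.trace_mul_comm, Matrix.toLin'.injective h0, Matrix.trace_zero]
  have htop : W T = ⊤ := Submodule.eq_top_of_finrank_eq <|
    le_antisymm (Submodule.finrank_le _) (by simpa [hT] using hdim T subset_rfl)
  have h0 : (Y T).mulVecLin = (0 : Matrix (Fin d) (Fin d) ℝ).mulVecLin := by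
    rw [Matrix.mulVecLin_zero]
    exact LinearMap.ker_eq_top.mp (top_le_iff.mp (htop ▸ hker T subset_rfl))
  refine hne (∅, T) (mem_disjointPairs.mpr ⟨by simp, subset_rfl, by simp⟩) ?_
  rw [Matrix.toLin'.injective h0, Matrix.mul_zero, Matrix.trace_zero]

/-- The disjoint pairs of subsets of `S` at which the trace pairing does not vanish. -/
noncomputable def tracePairs (S : Finset ι) (X Y : Finset ι → Matrix (Fin d) (Fin d) ℝ) :
    Finset (Finset ι × Finset ι) :=
  {p ∈ disjointPairs S | (X p.1 * Y p.2).trace ≠ 0}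

/-- `lowerSum X c a` sums `X` over all unions of `a` with a subset of `c`. -/
def lowerSum (X : Finset ι → Matrix (Fin d) (Fin d) ℝ) (c a : Finset ι) :
    Matrix (Fin d) (Fin d) ℝ :=
  ∑ e ∈ c.powerset, X (a ∪ e)

theorem posSemidef_lowerSum {X : Finset ι → Matrix (Fin d) (Fin d) ℝ}
    (hX : ∀ a, (X a).PosSemidef) (c a : Finset ι) : (lowerSum X c a).PosSemidef :=
  Matrix.posSemidef_sum _ fun _ _ => hX _

theorem trace_lowerSum_mul_lowerSum (X Y : Finset ι → Matrix (Fin d) (Fin d) ℝ)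
    (c c' a b : Finset ι) :
    (lowerSum X c a * lowerSum Y c' b).trace =
      ∑ e ∈ c.powerset, ∑ f ∈ c'.powerset, (X (a ∪ e) * Y (b ∪ f)).trace := by
  simp only [lowerSum, Finset.sum_mul, Finset.mul_sum, Matrix.trace_sum]
  exact sum_comm

theorem trace_lowerSum_ne_zero {X Y : Finset ι → Matrix (Fin d) (Fin d) ℝ}
    (hX : ∀ a, (X a).PosSemidef) (hY : ∀ a, (Y a).PosSemidef) {c c' a b e f : Finset ι}
    (he : e ⊆ c) (hf : f ⊆ c') (h : (X (a ∪ e) * Y (b ∪ f)).trace ≠ 0) :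
    (lowerSum X c a * lowerSum Y c' b).trace ≠ 0 := by
  have hnn : ∀ u v, 0 ≤ (X u * Y v).trace := fun u v => (hX u).trace_mul_nonneg (hY v)
  rw [trace_lowerSum_mul_lowerSum]
  intro h0
  rw [Finset.sum_eq_zero_iff_of_nonneg fun _ _ => Finset.sum_nonneg fun _ _ => hnn _ _] at h0
  have h1 := h0 e (by simpa using he)
  rw [Finset.sum_eq_zero_iff_of_nonneg fun _ _ => hnn _ _] at h1
  exact h (h1 f (by simpa using hf))

theorem union_inter_union_of_disjoint {S T a b e f : Finset ι} (hST : Disjoint S T)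
    (ha : a ⊆ S) (hb : b ⊆ S) (he : e ⊆ T) (hf : f ⊆ T) :
    (a ∪ e) ∩ (b ∪ f) = (a ∩ b) ∪ (e ∩ f) := by
  ext x
  have : x ∈ S → x ∉ T := fun h => Finset.disjoint_left.mp hST h
  have := @ha x
  have := @hb x
  have := @he x
  have := @hf x
  simp only [mem_inter, mem_union]
  tauto

theorem card_fiber_le {S T : Finset ι} (hST : Disjoint S T) (hT : T.card = d)
    {X Y : Finset ι → Matrix (Fin d) (Fin d) ℝ}
    (hX : ∀ a, (X a).PosSemidef) (hY : ∀ a, (Y a).PosSemidef)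
    (h1 : ∀ a ⊆ S ∪ T, ∀ b ⊆ S ∪ T, (a ∩ b).card = 1 → (X a * Y b).trace = 0)
    {p : Finset ι × Finset ι} (hp : p ∈ disjointPairs S) :
    #{c ∈ disjointPairs T | (X (p.1 ∪ c.1) * Y (p.2 ∪ c.2)).trace ≠ 0} ≤
      #{c ∈ (disjointPairs T).erase (∅, ∅) |
        (lowerSum X c.1 p.1 * lowerSum Y c.2 p.2).trace ≠ 0} := by
  obtain ⟨hp1, hp2, hp3⟩ := mem_disjointPairs.mp hp
  by_cases h0 : (X (p.1 ∪ ∅) * Y (p.2 ∪ ∅)).trace = 0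
  · refine card_le_card fun c hc => ?_
    simp only [mem_filter, mem_erase] at hc ⊢
    refine ⟨⟨?_, hc.1⟩, trace_lowerSum_ne_zero hX hY subset_rfl subset_rfl hc.2⟩
    rintro rfl
    exact hc.2 h0
  · have hall : {c ∈ (disjointPairs T).erase (∅, ∅) |
        (lowerSum X c.1 p.1 * lowerSum Y c.2 p.2).trace ≠ 0} = (disjointPairs T).erase (∅, ∅) :=
      filter_true_of_mem fun c _ =>
        trace_lowerSum_ne_zero hX hY (empty_subset _) (empty_subset _) h0
    rw [hall, card_erase_of_mem (mem_disjointPairs.mpr (by simp))]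
    refine Nat.le_sub_one_of_lt (card_lt_card (filter_ssubset.mpr ?_))
    obtain ⟨c, hc, hc0⟩ := exists_disjoint_trace_eq_zero hT (fun e => X (p.1 ∪ e))
      (fun e => Y (p.2 ∪ e)) (fun _ => hX _) (fun _ => hY _) fun e he f hf hef =>
        h1 _ (union_subset_union hp1 he) _ (union_subset_union hp2 hf) (by
          rwa [union_inter_union_of_disjoint hST hp1 hp2 he hf,
            disjoint_iff_inter_eq_empty.mp hp3, empty_union])
    exact ⟨c, hc, by simpa using hc0⟩

theorem card_tracePairs_union_le {S T : Finset ι} (hST : Disjoint S T) (hT : T.card = d)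
    {X Y : Finset ι → Matrix (Fin d) (Fin d) ℝ}
    (hX : ∀ a, (X a).PosSemidef) (hY : ∀ a, (Y a).PosSemidef)
    (h1 : ∀ a ⊆ S ∪ T, ∀ b ⊆ S ∪ T, (a ∩ b).card = 1 → (X a * Y b).trace = 0) :
    #(tracePairs (S ∪ T) X Y) ≤
      ∑ c ∈ (disjointPairs T).erase (∅, ∅), #(tracePairs S (lowerSum X c.1) (lowerSum Y c.2)) := by
  have hinj : #(tracePairs (S ∪ T) X Y) ≤ #((disjointPairs S).sigma fun p =>
      {c ∈ disjointPairs T | (X (p.1 ∪ c.1) * Y (p.2 ∪ c.2)).trace ≠ 0}) := by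
    have hsplit : ∀ a ⊆ S ∪ T, (a ∩ S) ∪ (a ∩ T) = a := fun a ha => by
      rw [← inter_union_distrib_left, inter_eq_left.mpr ha]
    refine card_le_card_of_injOn
      (fun p => ⟨(p.1 ∩ S, p.2 ∩ S), (p.1 ∩ T, p.2 ∩ T)⟩) ?_ ?_
    · intro p hp
      obtain ⟨hp, hne⟩ := mem_filter.mp hp
      obtain ⟨ha, hb, hab⟩ := mem_disjointPairs.mp hp
      simp only [coe_sigma, Set.mem_sigma_iff, mem_coe, mem_filter, mem_disjointPairs,
        hsplit _ ha, hsplit _ hb]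
      exact ⟨⟨inter_subset_right, inter_subset_right,
        hab.mono inter_subset_left inter_subset_left⟩, ⟨inter_subset_right, inter_subset_right,
        hab.mono inter_subset_left inter_subset_left⟩, hne⟩
    · intro p hp q hq hpq
      obtain ⟨ha, hb, -⟩ := mem_disjointPairs.mp (mem_filter.mp hp).1
      obtain ⟨ha', hb', -⟩ := mem_disjointPairs.mp (mem_filter.mp hq).1
      simp only [Sigma.mk.injEq, Prod.mk.injEq, heq_eq_eq] at hpq
      ext1
      · rw [← hsplit _ ha, ← hsplit _ ha', hpq.1.1, hpq.2.1]
      · rw [← hsplit _ hb, ← hsplit _ hb', hpq.1.2, hpq.2.2]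
  rw [card_sigma] at hinj
  refine hinj.trans ((sum_le_sum fun p hp => card_fiber_le hST hT hX hY h1 hp).trans_eq ?_)
  simp only [tracePairs, card_filter]
  exact sum_comm

theorem card_tracePairs_le (hd : 1 ≤ d) (S : Finset ι) (X Y : Finset ι → Matrix (Fin d) (Fin d) ℝ)
    (hX : ∀ a, (X a).PosSemidef) (hY : ∀ a, (Y a).PosSemidef)
    (h1 : ∀ a ⊆ S, ∀ b ⊆ S, (a ∩ b).card = 1 → (X a * Y b).trace = 0) :
    #(tracePairs S X Y) ≤ (3 ^ d - 1) ^ ((#S + d - 1) / d) := by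
  induction S using Finset.strongInduction generalizing X Y with
  | H S ih =>
  rcases lt_or_ge #S d with hlt | hge
  · have hle : #(tracePairs S X Y) ≤ 3 ^ #S :=
      (card_filter_le _ _).trans_eq (card_disjointPairs S)
    rcases Nat.eq_zero_or_pos #S with h0 | hpos
    · rw [h0, pow_zero] at hle
      rwa [h0, zero_add, Nat.div_eq_of_lt (by omega), pow_zero]
    · have hq : (#S + d - 1) / d = 1 := by
        rw [Nat.div_eq_iff (by omega)]; omega
      rw [hq, pow_one]
      exact hle.trans (Nat.le_sub_one_of_lt (Nat.pow_lt_pow_right (by norm_num) hlt))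
  · obtain ⟨T, hTS, hT⟩ := exists_subset_card_eq hge
    have hun : S \ T ∪ T = S := sdiff_union_of_subset hTS
    have hTne : T.Nonempty := card_pos.mp (by omega)
    have hstep := card_tracePairs_union_le (S := S \ T) sdiff_disjoint hT hX hY (by rwa [hun])
    rw [hun] at hstep
    refine hstep.trans ((sum_le_card_nsmul _ _ ((3 ^ d - 1) ^ ((#(S \ T) + d - 1) / d))
      fun c hc => ?_).trans_eq ?_)
    · obtain ⟨hc1, hc2, hc3⟩ := mem_disjointPairs.mp (mem_of_mem_erase hc)
      refine ih _ (sdiff_ssubset hTS hTne) _ _ (posSemidef_lowerSum hX _)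
        (posSemidef_lowerSum hY _) fun a ha b hb hab => ?_
      rw [trace_lowerSum_mul_lowerSum]
      refine sum_eq_zero fun e he => sum_eq_zero fun f hf => ?_
      have he' := mem_powerset.mp he
      have hf' := mem_powerset.mp hf
      refine h1 _ (union_subset (ha.trans sdiff_subset) (he'.trans (hc1.trans hTS))) _
        (union_subset (hb.trans sdiff_subset) (hf'.trans (hc2.trans hTS))) ?_
      rwa [union_inter_union_of_disjoint sdiff_disjoint ha hb (he'.trans hc1) (hf'.trans hc2),
        disjoint_iff_inter_eq_empty.mp (hc3.mono he' hf'), union_empty]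
    · rw [card_erase_of_mem (mem_disjointPairs.mpr (by simp)), card_disjointPairs, hT,
        smul_eq_mul, ← pow_succ', card_sdiff_of_subset hTS, hT]
      congr 1
      rw [← Nat.add_div_right _ (by omega)]
      congr 1
      omega

end Count

theorem bitIP_decide_mem {n : ℕ} (s t : Finset (Fin n)) :
    bitIP (fun i => decide (i ∈ s)) (fun i => decide (i ∈ t)) = (s ∩ t).card := by
  simp only [bitIP, Bool.and_eq_true, decide_eq_true_eq, Finset.sum_boole, Nat.cast_id]
  congr 1
  ext
  simp

theorem three_pow_le_mul_of_sum_eq_UDISJ {d : ℕ} (hd : 1 ≤ d) {n r : ℕ}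
    {A : Fin r → Matrix (BitStr n) (BitStr n) ℝ}
    (hnonneg : ∀ i a b, 0 ≤ A i a b) (hfact : ∀ i, HasPsdFactorization d (A i))
    (hsum : ∑ i, A i = UDISJ n) :
    3 ^ n ≤ r * (3 ^ d - 1) ^ ((n + d - 1) / d) := by
  choose X Y hX hY hA using hfact
  let v : Finset (Fin n) → BitStr n := fun s i => decide (i ∈ s)
  have hentry : ∀ s t, ∑ i, A i (v s) (v t) = (1 - ((s ∩ t).card : ℝ)) ^ 2 := fun s t => by
    rw [← Matrix.sum_apply, hsum, UDISJ, Matrix.of_apply, bitIP_decide_mem]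
  have hcover : disjointPairs (Finset.univ : Finset (Fin n)) ⊆
      Finset.univ.biUnion fun i : Fin r =>
        tracePairs Finset.univ (fun s => X i (v s)) (fun s => Y i (v s)) := by
    intro p hp
    have hp3 := (mem_disjointPairs.mp hp).2.2
    have h := hentry p.1 p.2
    rw [Finset.disjoint_iff_inter_eq_empty.mp hp3, Finset.card_empty, Nat.cast_zero, sub_zero,
      one_pow] at h
    obtain ⟨i, -, hi⟩ := Finset.exists_ne_zero_of_sum_ne_zero (h.trans_ne one_ne_zero)
    exact Finset.mem_biUnion.mpr ⟨i, Finset.mem_univ i, Finset.mem_filter.mpr ⟨hp, hA i _ _ ▸ hi⟩⟩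
  have hcard := (Finset.card_le_card hcover).trans (Finset.card_biUnion_le_card_mul _ _
    ((3 ^ d - 1) ^ ((n + d - 1) / d)) fun i _ => by
      simpa using card_tracePairs_le hd Finset.univ _ _ (fun s => hX i (v s))
        (fun s => hY i (v s)) fun s _ t _ hst => by
          have h := hentry s t
          rw [hst, Nat.cast_one, sub_self, zero_pow two_ne_zero,
            Finset.sum_eq_zero_iff_of_nonneg fun _ _ => hnonneg _ _ _] at h
          rw [← hA i]
          exact h i (Finset.mem_univ i))
  simpa [card_disjointPairs] using hcard

theorem rpow_mul_rpow_pow_le_div {d n : ℕ} (hd : 1 ≤ d) (hn : 1 ≤ n) :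
    Real.rpow ((3 : ℝ) ^ d - 1) (-(1 - 1 / (d : ℝ))) *
      (Real.rpow (1 - ((3 : ℝ) ^ d)⁻¹) (-(1 / (d : ℝ)))) ^ n ≤
    (3 : ℝ) ^ n / ((3 : ℝ) ^ d - 1) ^ ((n - 1) / d + 1) := by
  simp only [Real.rpow_eq_pow]
  have hd0 : (0 : ℝ) < d := by exact_mod_cast hd
  have h3 : (3 : ℝ) ≤ 3 ^ d := le_self_pow₀ (by norm_num) (by omega)
  set Q : ℝ := 3 ^ d - 1 with hQ
  have hQ1 : 1 ≤ Q := by linarith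
  have hQ0 : 0 < Q := by linarith
  have hbase : 1 - ((3 : ℝ) ^ d)⁻¹ = Q / 3 ^ d := by
    rw [hQ]; field_simp
  have hroot : ((3 : ℝ) ^ d) ^ (-(1 / (d : ℝ))) = 3⁻¹ := by
    rw [← Real.rpow_natCast, ← Real.rpow_mul (by norm_num), ← Real.rpow_neg_one]
    congr 1
    field_simp
  have hlhs : Q ^ (-(1 - 1 / (d : ℝ))) * ((1 - ((3 : ℝ) ^ d)⁻¹) ^ (-(1 / (d : ℝ)))) ^ n =
      3 ^ n * Q ^ (-(((n : ℝ) - 1) / d + 1)) := by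
    rw [hbase, Real.div_rpow hQ0.le (by positivity), hroot, div_inv_eq_mul, mul_pow,
      ← Real.rpow_mul_natCast hQ0.le, mul_comm _ ((3 : ℝ) ^ n), mul_left_comm,
      ← Real.rpow_add hQ0]
    congr 2
    field_simp
    ring
  rw [hlhs, div_eq_mul_inv (3 ^ n : ℝ), ← Real.rpow_natCast Q, ← Real.rpow_neg hQ0.le]
  refine mul_le_mul_of_nonneg_left (Real.rpow_le_rpow_of_exponent_le hQ1 ?_) (by positivity)
  have hfloor : (((n - 1) / d : ℕ) : ℝ) ≤ ((n : ℝ) - 1) / d := by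
    simpa [Nat.cast_sub hn] using Nat.cast_div_le (α := ℝ) (m := n - 1) (n := d)
  push_cast
  linarith

/-- For fixed `d ≥ 1` and `n ≥ d`:
`rank_{S^d_+}(UDISJ(n)) ≥ 3^n / (3^d - 1)^{⌊(n-1)/d⌋ + 1}`, and consequently
`rank_{S^d_+}(UDISJ(n)) ≥ (3^d - 1)^{-(1-1/d)} · ((1 - 3^{-d})^{-1/d})^n`.
(`rank_{S^d_+}` being the least number of terms in a decomposition of `UDISJ(n)` as a
sum of nonnegative matrices each admitting an `S^d_+`-factorization, the bounds are
stated for the number of terms `r` of an arbitrary such decomposition.) -/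
theorem rank_psd_blocks_udisj_lower_bound (d : ℕ) (hd : 1 ≤ d) (n : ℕ) (hn : d ≤ n)
    (r : ℕ) (A : Fin r → Matrix (BitStr n) (BitStr n) ℝ)
    (hnonneg : ∀ i a b, 0 ≤ A i a b)
    (hfact : ∀ i, HasPsdFactorization d (A i))
    (hsum : ∑ i, A i = UDISJ n) :
    (3 : ℝ) ^ n / ((3 : ℝ) ^ d - 1) ^ ((n - 1) / d + 1) ≤ (r : ℝ) ∧
    Real.rpow ((3 : ℝ) ^ d - 1) (-(1 - 1 / (d : ℝ))) *
      (Real.rpow (1 - ((3 : ℝ) ^ d)⁻¹) (-(1 / (d : ℝ)))) ^ n ≤ (r : ℝ) := by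
  have hQ : (0 : ℝ) < 3 ^ d - 1 := sub_pos.mpr (one_lt_pow₀ (by norm_num) (by omega))
  have hceil : (n + d - 1) / d = (n - 1) / d + 1 := by
    rw [← Nat.add_div_right _ (by omega)]
    congr 1
    omega
  have hcount := three_pow_le_mul_of_sum_eq_UDISJ hd hnonneg hfact hsum
  rw [hceil] at hcount
  have hmain : (3 : ℝ) ^ n / ((3 : ℝ) ^ d - 1) ^ ((n - 1) / d + 1) ≤ (r : ℝ) := by
    rw [div_le_iff₀ (by positivity)]
    have h := (Nat.cast_le (α := ℝ)).mpr hcount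
    rwa [Nat.cast_mul, Nat.cast_pow, Nat.cast_pow, Nat.cast_sub (Nat.one_le_pow _ _ (by norm_num)),
      Nat.cast_pow, Nat.cast_one, Nat.cast_ofNat] at h
  exact ⟨hmain, (rpow_mul_rpow_pow_le_div hd (hd.trans hn)).trans hmain⟩
end

section
/- For every n ≥ 2, rank_{S^2_+}(UDISJ(n)) ≥ (1/√7) · (√(9/7))^n. -/
/-- The trace of a product of `2 × 2` matrices, written in entries. -/
lemma trace_mul_fin_two (X Y : Matrix (Fin 2) (Fin 2) ℝ) :
    (X * Y).trace = X 0 0 * Y 0 0 + X 0 1 * Y 1 0 + X 1 0 * Y 0 1 + X 1 1 * Y 1 1 := by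
  simp [Matrix.trace, Matrix.mul_apply, Fin.sum_univ_two]
  ring

lemma posSemidef_fin_two_entries {X : Matrix (Fin 2) (Fin 2) ℝ} (hX : X.PosSemidef) :
    X 1 0 = X 0 1 ∧ 0 ≤ X 0 0 ∧ 0 ≤ X 1 1 ∧ X 0 1 ^ 2 ≤ X 0 0 * X 1 1 := by
  have hsymm : X 1 0 = X 0 1 := by simpa using hX.isHermitian.apply 0 1
  refine ⟨hsymm, hX.diag_nonneg, hX.diag_nonneg, ?_⟩
  have hdet := hX.det_nonneg
  rw [Matrix.det_fin_two, hsymm] at hdet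
  nlinarith

lemma trace_mul_nonneg_of_posSemidef {X Y : Matrix (Fin 2) (Fin 2) ℝ}
    (hX : X.PosSemidef) (hY : Y.PosSemidef) : 0 ≤ (X * Y).trace := by
  obtain ⟨hx, hx0, hx1, hxd⟩ := posSemidef_fin_two_entries hX
  obtain ⟨hy, hy0, hy1, hyd⟩ := posSemidef_fin_two_entries hY
  rw [trace_mul_fin_two, hx, hy]
  have h : (2 * (X 0 1 * Y 0 1)) ^ 2 ≤ (X 0 0 * Y 0 0 + X 1 1 * Y 1 1) ^ 2 := by
    nlinarith [mul_le_mul hxd hyd (sq_nonneg _) (mul_nonneg hx0 hx1),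
      sq_nonneg (X 0 0 * Y 0 0 - X 1 1 * Y 1 1)]
  have := (abs_le.mp (abs_le_of_sq_le_sq h (by positivity))).1
  linarith

/-- Orthogonal `2 × 2` positive semidefinite matrices are, up to scaling, adjugates of
each other. -/
lemma smul_eq_smul_adjugate_of_trace_mul_eq_zero {X Y : Matrix (Fin 2) (Fin 2) ℝ}
    (hX : X.PosSemidef) (hY : Y.PosSemidef) (h : (X * Y).trace = 0) :
    X.trace • Y = Y.trace • X.adjugate := by
  obtain ⟨hx, hx0, hx1, hxd⟩ := posSemidef_fin_two_entries hX
  obtain ⟨hy, hy0, hy1, hyd⟩ := posSemidef_fin_two_entries hY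
  rw [trace_mul_fin_two, hx, hy] at h
  have hsq : (X 0 0 * Y 0 0 - X 1 1 * Y 1 1) ^ 2 ≤ 0 := by
    have : X 0 0 * Y 0 0 + X 1 1 * Y 1 1 = - (2 * (X 0 1 * Y 0 1)) := by linarith
    have h2 : (X 0 0 * Y 0 0 + X 1 1 * Y 1 1) ^ 2 = (2 * (X 0 1 * Y 0 1)) ^ 2 := by
      rw [this, neg_sq]
    nlinarith [mul_le_mul hxd hyd (sq_nonneg _) (mul_nonneg hx0 hx1)]
  have hdiag : X 0 0 * Y 0 0 = X 1 1 * Y 1 1 := by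
    have := pow_eq_zero_iff (two_ne_zero) |>.mp (le_antisymm hsq (sq_nonneg _))
    linarith
  have hoff : (X 0 0 + X 1 1) * Y 0 1 + (Y 0 0 + Y 1 1) * X 0 1 = 0 := by
    have hle : ((X 0 0 + X 1 1) * Y 0 1 + (Y 0 0 + Y 1 1) * X 0 1) ^ 2 ≤ 0 := by
      have hxy : X 0 1 * Y 0 1 = - (X 0 0 * Y 0 0) := by linarith
      have e1 : (X 0 0 + X 1 1) ^ 2 * Y 0 1 ^ 2 ≤ (X 0 0 + X 1 1) ^ 2 * (Y 0 0 * Y 1 1) :=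
        mul_le_mul_of_nonneg_left hyd (sq_nonneg _)
      have e2 : (Y 0 0 + Y 1 1) ^ 2 * X 0 1 ^ 2 ≤ (Y 0 0 + Y 1 1) ^ 2 * (X 0 0 * X 1 1) :=
        mul_le_mul_of_nonneg_left hxd (sq_nonneg _)
      have e3 : ((X 0 0 + X 1 1) * Y 0 1 + (Y 0 0 + Y 1 1) * X 0 1) ^ 2 =
          (X 0 0 + X 1 1) ^ 2 * Y 0 1 ^ 2 + (Y 0 0 + Y 1 1) ^ 2 * X 0 1 ^ 2 +
          2 * (X 0 0 + X 1 1) * (Y 0 0 + Y 1 1) * (X 0 1 * Y 0 1) := by ring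
      have e4 : (X 0 0 + X 1 1) ^ 2 * (Y 0 0 * Y 1 1) + (Y 0 0 + Y 1 1) ^ 2 * (X 0 0 * X 1 1) =
          2 * (X 0 0 + X 1 1) * (Y 0 0 + Y 1 1) * (X 0 0 * Y 0 0) := by
        linear_combination -(X 0 0 * Y 1 1 + X 1 1 * Y 0 0 + 2 * (X 0 0 * Y 0 0)) * hdiag
      rw [e3, hxy]
      linarith
    exact pow_eq_zero_iff (two_ne_zero) |>.mp (le_antisymm hle (sq_nonneg _))
  rw [Matrix.adjugate_fin_two]
  ext i j
  fin_cases i <;> fin_cases j <;> simp [Matrix.trace, Fin.sum_univ_two, hx, hy] <;> linarith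

/-- Zero patterns of `S^2_+`-factorizations: three zeros in a `2 × 2` minor force a fourth one,
unless the row or the column of the pivot vanishes. -/
lemma trace_mul_eq_zero_of_corner {X X' Y Y' U V : Matrix (Fin 2) (Fin 2) ℝ}
    (hX : X.PosSemidef) (hX' : X'.PosSemidef) (hY : Y.PosSemidef) (hY' : Y'.PosSemidef)
    (hXY : (X * Y).trace = 0) (hXY' : (X * Y').trace = 0) (hX'Y : (X' * Y).trace = 0)
    (hXV : (X * V).trace ≠ 0) (hUY : (U * Y).trace ≠ 0) : (X' * Y').trace = 0 := by
  have hX0 : X.trace ≠ 0 := fun h => hXV (by simp [hX.trace_eq_zero_iff.mp h])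
  have hY0 : Y.trace ≠ 0 := fun h => hUY (by simp [hY.trace_eq_zero_iff.mp h])
  have h1 := smul_eq_smul_adjugate_of_trace_mul_eq_zero hX hY' hXY'
  have h2 := smul_eq_smul_adjugate_of_trace_mul_eq_zero hY hX' (by rwa [Matrix.trace_mul_comm])
  have h3 : ((Y.trace • X') * (X.trace • Y')).trace = 0 := by
    rw [h1, h2, Matrix.smul_mul, Matrix.mul_smul, Matrix.trace_smul, Matrix.trace_smul,
      ← Matrix.adjugate_mul_distrib]
    have : (X * Y).adjugate.trace = (X * Y).trace := by
      rw [Matrix.adjugate_fin_two]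
      simp [Matrix.trace, Fin.sum_univ_two, add_comm]
    simp [this, hXY]
  simpa [hX0, hY0] using h3

lemma bitIP_cons {n : ℕ} (x y : Bool) (a b : BitStr n) :
    bitIP (n := n + 1) (Fin.cons x a) (Fin.cons y b) =
      (if x && y then 1 else 0) + bitIP a b := by
  simp only [bitIP, Fin.sum_univ_succ, Fin.cons_zero, Fin.cons_succ]

lemma sum_bitStr_succ {n : ℕ} (F : BitStr (n + 1) → ℕ) :
    ∑ a, F a = ∑ a : BitStr n, (F (Fin.cons false a) + F (Fin.cons true a)) := by
  rw [← (Fin.consEquiv (fun _ : Fin (n + 1) => Bool)).sum_comp, Fintype.sum_prod_type]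
  simp [Fin.consEquiv, Finset.sum_add_distrib, add_comm]

lemma card_disjoint_pairs (n : ℕ) :
    ∑ a : BitStr n, ∑ b : BitStr n, (if bitIP a b = 0 then 1 else 0) = 3 ^ n := by
  induction n with
  | zero => simp [bitIP]
  | succ n ih =>
    rw [sum_bitStr_succ]
    simp only [sum_bitStr_succ, bitIP_cons]
    rw [pow_succ, ← ih, Finset.sum_mul]
    refine Finset.sum_congr rfl fun a _ => ?_
    rw [← Finset.sum_add_distrib, Finset.sum_mul]
    refine Finset.sum_congr rfl fun b _ => ?_
    by_cases h : bitIP a b = 0 <;> simp [h]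

open Classical in
/-- The indicator of `Tr(X Y) ≠ 0`. -/
noncomputable def overlap (X Y : Matrix (Fin 2) (Fin 2) ℝ) : ℕ :=
  if (X * Y).trace ≠ 0 then 1 else 0

/-- The number of disjoint pairs in the support of the matrix factorized by `X` and `Y`. -/
noncomputable def disjointSupport {n : ℕ} (X Y : BitStr n → Matrix (Fin 2) (Fin 2) ℝ) : ℕ :=
  ∑ a, ∑ b, if bitIP a b = 0 then overlap (X a) (Y b) else 0

lemma overlap_le_one (X Y : Matrix (Fin 2) (Fin 2) ℝ) : overlap X Y ≤ 1 := by
  unfold overlap; split_ifs <;> simp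

lemma overlap_ne_zero_iff {X Y : Matrix (Fin 2) (Fin 2) ℝ} :
    overlap X Y ≠ 0 ↔ (X * Y).trace ≠ 0 := by
  simp [overlap]

lemma overlap_le_add_left {X X' Y : Matrix (Fin 2) (Fin 2) ℝ} (hX : X.PosSemidef)
    (hX' : X'.PosSemidef) (hY : Y.PosSemidef) :
    overlap X Y ≤ overlap (X + X') Y ∧ overlap X' Y ≤ overlap (X + X') Y := by
  have h := trace_mul_nonneg_of_posSemidef hX hY
  have h' := trace_mul_nonneg_of_posSemidef hX' hY
  unfold overlap
  rw [add_mul, Matrix.trace_add]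
  constructor <;> split_ifs with h1 h2 <;> grind

lemma overlap_le_add_right {X Y Y' : Matrix (Fin 2) (Fin 2) ℝ} (hX : X.PosSemidef)
    (hY : Y.PosSemidef) (hY' : Y'.PosSemidef) :
    overlap X Y ≤ overlap X (Y + Y') ∧ overlap X Y' ≤ overlap X (Y + Y') := by
  have comm (U V) : overlap U V = overlap V U := by simp [overlap, Matrix.trace_mul_comm U V]
  simpa [comm X] using overlap_le_add_left hY hY' hX

/-- A weighted covering inequality for nine `0`-`1` values arranged in four `2 × 2` or `1 × 4`
rectangles with values `R`, `C`, `P`, `Q`. -/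
lemma four_mul_sum_le_of_cover {z a₁ a₂ a₃ b₁ b₂ b₃ d e R C P Q : ℕ}
    (hz : z ≤ 1) (ha₁ : a₁ ≤ 1) (ha₂ : a₂ ≤ 1) (ha₃ : a₃ ≤ 1) (hb₁ : b₁ ≤ 1) (hb₂ : b₂ ≤ 1)
    (hb₃ : b₃ ≤ 1) (hd : d ≤ 1) (he : e ≤ 1)
    (c₁ : b₂ ≠ 0 → a₃ ≠ 0 → d = 0) (c₂ : b₃ ≠ 0 → a₁ ≠ 0 → d = 0)
    (c₃ : b₁ ≠ 0 → a₃ ≠ 0 → e = 0) (c₄ : b₃ ≠ 0 → a₂ ≠ 0 → e = 0)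
    (hR₀ : z ≤ R) (hR₁ : a₁ ≤ R) (hR₂ : a₂ ≤ R) (hR₃ : a₃ ≤ R)
    (hC₀ : z ≤ C) (hC₁ : b₁ ≤ C) (hC₂ : b₂ ≤ C) (hC₃ : b₃ ≤ C)
    (hP₀ : z ≤ P) (hP₁ : a₂ ≤ P) (hP₂ : b₁ ≤ P) (hP₃ : d ≤ P)
    (hQ₀ : z ≤ Q) (hQ₁ : a₁ ≤ Q) (hQ₂ : b₂ ≤ Q) (hQ₃ : e ≤ Q) :
    4 * (z + a₁ + a₂ + a₃ + b₁ + b₂ + b₃ + d + e) ≤ 7 * (R + C + P + Q) := by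
  have hseven : z + a₁ + a₂ + a₃ + b₁ + b₂ + b₃ + d + e ≤ 7 := by
    have k₁ : b₂ + a₃ + d ≤ 2 := by clear c₂ c₃ c₄; omega
    have k₂ : b₃ + a₁ + d ≤ 2 := by clear c₁ c₃ c₄; omega
    have k₃ : b₁ + a₃ + e ≤ 2 := by clear c₁ c₂ c₄; omega
    have k₄ : b₃ + a₂ + e ≤ 2 := by clear c₁ c₂ c₃; omega
    clear c₁ c₂ c₃ c₄ hR₀ hR₁ hR₂ hR₃ hC₀ hC₁ hC₂ hC₃ hP₀ hP₁ hP₂ hP₃ hQ₀ hQ₁ hQ₂ hQ₃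
    interval_cases d <;> interval_cases e <;> omega
  clear c₁ c₂ c₃ c₄
  rcases Nat.eq_zero_or_pos R with rfl | hR <;> rcases Nat.eq_zero_or_pos C with rfl | hC <;>
    rcases Nat.eq_zero_or_pos P with rfl | hP <;> rcases Nat.eq_zero_or_pos Q with rfl | hQ <;>
    linarith

/-- The local inequality behind the recursion: the nine disjoint patterns on two coordinates
are covered by four combinatorial rectangles, and no more than seven of them can be in the
support simultaneously. -/
lemma overlap_two_coordinates (x y : Bool → Bool → Matrix (Fin 2) (Fin 2) ℝ)
    (hx : ∀ s t, (x s t).PosSemidef) (hy : ∀ s t, (y s t).PosSemidef)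
    (h : ∀ s t u v, (if s && u then 1 else 0) + (if t && v then 1 else 0) = 1 →
      (x s t * y u v).trace = 0) :
    4 * (overlap (x false false) (y false false) + overlap (x false false) (y false true)
        + overlap (x false false) (y true false) + overlap (x false false) (y true true)
        + overlap (x false true) (y false false) + overlap (x true false) (y false false)
        + overlap (x true true) (y false false) + overlap (x false true) (y true false)
        + overlap (x true false) (y false true)) ≤
      7 * (overlap (x false false)
            ((y false false + y false true) + (y true false + y true true))
          + overlap ((x false false + x false true) + (x true false + x true true))
            (y false false)
          + overlap (x false false + x false true) (y false false + y true false)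
          + overlap (x false false + x true false) (y false false + y false true)) := by
  have corner (s t u v s' t' u' v') (h1 : (x s t * y u v).trace = 0)
      (h2 : (x s t * y u' v').trace = 0) (h3 : (x s' t' * y u v).trace = 0)
      (h4 : overlap (x s t) (y false false) ≠ 0) (h5 : overlap (x false false) (y u v) ≠ 0) :
      overlap (x s' t') (y u' v') = 0 := by
    have := trace_mul_eq_zero_of_corner (hx s t) (hx s' t') (hy u v) (hy u' v') h1 h2 h3
      (overlap_ne_zero_iff.mp h4) (overlap_ne_zero_iff.mp h5)
    simp [overlap, this]
  have c1 := corner true false true true false true true false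
    (h _ _ _ _ rfl) (h _ _ _ _ rfl) (h _ _ _ _ rfl)
  have c2 := corner true true false true false true true false
    (h _ _ _ _ rfl) (h _ _ _ _ rfl) (h _ _ _ _ rfl)
  have c3 := corner false true true true true false false true
    (h _ _ _ _ rfl) (h _ _ _ _ rfl) (h _ _ _ _ rfl)
  have c4 := corner true true true false true false false true
    (h _ _ _ _ rfl) (h _ _ _ _ rfl) (h _ _ _ _ rfl)
  have hx' (s t s' t') := (hx s t).add (hx s' t')
  have hy' (s t s' t') := (hy s t).add (hy s' t')
  have row := overlap_le_add_right (hx false false) (hy' false false false true)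
    (hy' true false true true)
  have row0 := overlap_le_add_right (hx false false) (hy false false) (hy false true)
  have row1 := overlap_le_add_right (hx false false) (hy true false) (hy true true)
  have col := overlap_le_add_left (hx' false false false true) (hx' true false true true)
    (hy false false)
  have col0 := overlap_le_add_left (hx false false) (hx false true) (hy false false)
  have col1 := overlap_le_add_left (hx true false) (hx true true) (hy false false)
  have p := overlap_le_add_left (hx false false) (hx false true) (hy' false false true false)
  have p0 := overlap_le_add_right (hx false false) (hy false false) (hy true false)
  have p1 := overlap_le_add_right (hx false true) (hy false false) (hy true false)
  have q := overlap_le_add_left (hx false false) (hx true false) (hy' false false false true)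
  have q0 := overlap_le_add_right (hx false false) (hy false false) (hy false true)
  have q1 := overlap_le_add_right (hx true false) (hy false false) (hy false true)
  have b (s t u v) := overlap_le_one (x s t) (y u v)
  have b1 := b false false false false
  have b2 := b false false false true
  have b3 := b false false true false
  have b4 := b false false true true
  have b5 := b false true false false
  have b6 := b true false false false
  have b7 := b true true false false
  have b8 := b false true true false
  have b9 := b true false false true
  exact four_mul_sum_le_of_cover b1 b2 b3 b4 b5 b6 b7 b8 b9 c1 c2 c3 c4
    (row0.1.trans row.1) (row0.2.trans row.1) (row1.1.trans row.2) (row1.2.trans row.2)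
    (col0.1.trans col.1) (col0.2.trans col.1) (col1.1.trans col.2) (col1.2.trans col.2)
    (p0.1.trans p.1) (p0.2.trans p.1) (p1.1.trans p.2) (p1.2.trans p.2)
    (q0.1.trans q.1) (q0.2.trans q.1) (q1.1.trans q.2) (q1.2.trans q.2)

lemma disjointSupport_le {n : ℕ} (X Y : BitStr (n + 2) → Matrix (Fin 2) (Fin 2) ℝ)
    (hX : ∀ a, (X a).PosSemidef) (hY : ∀ b, (Y b).PosSemidef)
    (h : ∀ a b, bitIP a b = 1 → (X a * Y b).trace = 0) (x y : Bool → Bool → BitStr n →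
      Matrix (Fin 2) (Fin 2) ℝ) (hx : ∀ s t a, x s t a = X (Fin.cons s (Fin.cons t a)))
    (hy : ∀ s t b, y s t b = Y (Fin.cons s (Fin.cons t b))) :
    4 * disjointSupport X Y ≤
      7 * (disjointSupport (x false false)
            ((y false false + y false true) + (y true false + y true true))
          + disjointSupport ((x false false + x false true) + (x true false + x true true))
            (y false false)
          + disjointSupport (x false false + x false true) (y false false + y true false)
          + disjointSupport (x false false + x true false) (y false false + y false true)) := by
  simp only [disjointSupport, sum_bitStr_succ (n := n + 1), sum_bitStr_succ (n := n), bitIP_cons,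
    ← hx, ← hy, ← Finset.sum_add_distrib, Finset.mul_sum]
  refine Finset.sum_le_sum fun a _ => Finset.sum_le_sum fun b _ => ?_
  by_cases hab : bitIP a b = 0
  · have := overlap_two_coordinates (fun s t => x s t a) (fun s t => y s t b)
      (fun s t => hx s t a ▸ hX _) (fun s t => hy s t b ▸ hY _) (fun s t u v hst => by
        simp only [hx, hy]
        exact h _ _ (by rw [bitIP_cons, bitIP_cons, hab, add_zero, hst]))
    simp [hab] at this ⊢
    linarith
  · simp [hab]

/-- The support of a matrix with an `S^2_+`-factorization that vanishes on all pairs meeting in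
exactly one position contains at most `√7 ^ (n + 1)` disjoint pairs. -/
lemma disjointSupport_le_sqrt_pow (n : ℕ) : ∀ (X Y : BitStr n → Matrix (Fin 2) (Fin 2) ℝ),
    (∀ a, (X a).PosSemidef) → (∀ b, (Y b).PosSemidef) →
    (∀ a b, bitIP a b = 1 → (X a * Y b).trace = 0) →
    (disjointSupport X Y : ℝ) ≤ Real.sqrt 7 ^ (n + 1) := by
  have hs : Real.sqrt 7 ^ 2 = 7 := Real.sq_sqrt (by norm_num)
  have trivial_bound (m : ℕ) (X Y : BitStr m → Matrix (Fin 2) (Fin 2) ℝ) :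
      disjointSupport X Y ≤ 3 ^ m := by
    rw [← card_disjoint_pairs]
    refine Finset.sum_le_sum fun a _ => Finset.sum_le_sum fun b _ => ?_
    split_ifs
    exacts [overlap_le_one _ _, le_rfl]
  induction n using Nat.twoStepInduction with
  | zero =>
    intro X Y _ _ _
    have : (disjointSupport X Y : ℝ) ≤ 3 ^ 0 := mod_cast trivial_bound 0 X Y
    refine this.trans ?_
    rw [zero_add, pow_one, pow_zero]
    exact Real.one_le_sqrt.mpr (by norm_num)
  | one =>
    intro X Y _ _ _
    have : (disjointSupport X Y : ℝ) ≤ 3 ^ 1 := mod_cast trivial_bound 1 X Y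
    norm_num at this ⊢
    linarith
  | more n ih _ =>
    intro X Y hX hY h
    let x : Bool → Bool → BitStr n → Matrix (Fin 2) (Fin 2) ℝ :=
      fun s t a => X (Fin.cons s (Fin.cons t a))
    let y : Bool → Bool → BitStr n → Matrix (Fin 2) (Fin 2) ℝ :=
      fun s t a => Y (Fin.cons s (Fin.cons t a))
    have key := disjointSupport_le X Y hX hY h x y (fun _ _ _ => rfl) (fun _ _ _ => rfl)
    have hx (s t a) : (x s t a).PosSemidef := hX _
    have hy (s t a) : (y s t a).PosSemidef := hY _
    have hz (s t u v) (hst : (s && u) = false ∧ (t && v) = false) (a b) (hab : bitIP a b = 1) :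
        (x s t a * y u v b).trace = 0 :=
      h _ _ (by rw [bitIP_cons, bitIP_cons, hst.1, hst.2, hab]; rfl)
    have k1 := ih (x false false) ((y false false + y false true) + (y true false + y true true))
      (hx _ _) (fun b => ((hy _ _ b).add (hy _ _ b)).add ((hy _ _ b).add (hy _ _ b)))
      (fun a b hab => by simp [mul_add, hz _ _ _ _ _ a b hab])
    have k2 := ih ((x false false + x false true) + (x true false + x true true)) (y false false)
      (fun b => ((hx _ _ b).add (hx _ _ b)).add ((hx _ _ b).add (hx _ _ b))) (hy _ _)
      (fun a b hab => by simp [add_mul, hz _ _ _ _ _ a b hab])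
    have k3 := ih (x false false + x false true) (y false false + y true false)
      (fun b => (hx _ _ b).add (hx _ _ b)) (fun b => (hy _ _ b).add (hy _ _ b))
      (fun a b hab => by simp [add_mul, mul_add, hz _ _ _ _ _ a b hab])
    have k4 := ih (x false false + x true false) (y false false + y false true)
      (fun b => (hx _ _ b).add (hx _ _ b)) (fun b => (hy _ _ b).add (hy _ _ b))
      (fun a b hab => by simp [add_mul, mul_add, hz _ _ _ _ _ a b hab])
    have key' := (Nat.cast_le (α := ℝ)).mpr key
    push_cast at key'
    rw [show n + 2 + 1 = (n + 1) + 2 by ring, pow_add, hs]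
    linarith

/-- For every `n ≥ 2`, `rank_{S^2_+}(UDISJ(n)) ≥ (1/√7)·(√(9/7))^n`:
any decomposition of `UDISJ(n)` as a sum of `r` nonnegative matrices each admitting an
`S^2_+`-factorization satisfies `r ≥ (1/√7)·(√(9/7))^n`. -/
theorem rank_psd2_udisj_lower_bound (n : ℕ) (hn : 2 ≤ n)
    (r : ℕ) (A : Fin r → Matrix (BitStr n) (BitStr n) ℝ)
    (hnonneg : ∀ i a b, 0 ≤ A i a b)
    (hfact : ∀ i, HasPsdFactorization 2 (A i))
    (hsum : ∑ i, A i = UDISJ n) :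
    (1 / Real.sqrt 7) * (Real.sqrt (9 / 7)) ^ n ≤ (r : ℝ) := by
  choose X Y hX hY hA using hfact
  have hentry (a b) : ∑ i, A i a b = (1 - (bitIP a b : ℝ)) ^ 2 := by
    have := congrFun (congrFun hsum a) b
    simpa [UDISJ, Matrix.sum_apply] using this
  have hbound (i) : (disjointSupport (X i) (Y i) : ℝ) ≤ Real.sqrt 7 ^ (n + 1) := by
    refine disjointSupport_le_sqrt_pow n _ _ (hX i) (hY i) fun a b hab => ?_
    have h0 : ∑ i, A i a b = 0 := by simp [hentry, hab]
    rw [← hA]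
    exact (Finset.sum_eq_zero_iff_of_nonneg (f := fun i => A i a b)
      fun i _ => hnonneg i a b).mp h0 i (Finset.mem_univ i)
  have hcover : 3 ^ n ≤ ∑ i, disjointSupport (X i) (Y i) := by
    simp only [disjointSupport]
    rw [← card_disjoint_pairs, Finset.sum_comm (s := (Finset.univ : Finset (Fin r)))]
    refine Finset.sum_le_sum fun a _ => ?_
    rw [Finset.sum_comm (s := (Finset.univ : Finset (Fin r)))]
    refine Finset.sum_le_sum fun b _ => ?_
    split_ifs with hab
    · rw [Nat.one_le_iff_ne_zero]
      intro h0
      have h1 : ∑ i, A i a b = 0 := Finset.sum_eq_zero fun i hi => by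
        rw [hA]
        by_contra hne
        exact overlap_ne_zero_iff.mpr hne (Finset.sum_eq_zero_iff.mp h0 i hi)
      rw [hentry, hab] at h1
      norm_num at h1
    · exact Nat.zero_le _
  have hmain : (3 : ℝ) ^ n ≤ r * Real.sqrt 7 ^ (n + 1) := by
    calc (3 : ℝ) ^ n ≤ ∑ i, (disjointSupport (X i) (Y i) : ℝ) := mod_cast hcover
      _ ≤ ∑ _i : Fin r, Real.sqrt 7 ^ (n + 1) := Finset.sum_le_sum fun i _ => hbound i
      _ = r * Real.sqrt 7 ^ (n + 1) := by simp
  have h9 : Real.sqrt 9 = 3 := by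
    rw [show (9 : ℝ) = 3 ^ 2 by norm_num, Real.sqrt_sq (by norm_num)]
  have hpos : 0 < Real.sqrt 7 := Real.sqrt_pos.mpr (by norm_num)
  rw [Real.sqrt_div (by norm_num), h9, div_pow, div_mul_div_comm, one_mul, ← pow_succ',
    div_le_iff₀ (by positivity)]
  exact hmain
end

section
/- Let K ⊆ ℝ^m be a convex cone and let d ∈ ℕ. Assume that the set A_K(d) has a k-uniform-covering. Then for every n ≥ d and every matrix M ∈ A_K(n), it holds that val(M) ≤ k^{⌊(n−1)/d⌋ + 1}. -/
/-- `val M`: the number of pairs `(a,b) ∈ {0,1}ⁿ × {0,1}ⁿ` with `aᵀb = 0` and `M a b > 0`. -/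
noncomputable def valM {n : ℕ} (M : Matrix (BitStr n) (BitStr n) ℝ) : ℕ :=
  (Finset.univ.filter fun p : BitStr n × BitStr n =>
    bitIP p.1 p.2 = 0 ∧ 0 < M p.1 p.2).card

/-- `M` admits a `K`-factorization: `M a b = ⟨x_a, y_b⟩` with all `x_a, y_b ∈ K ⊆ ℝ^m`. -/
def HasConeFactorization {m : ℕ} (K : Set (Fin m → ℝ)) {n : ℕ}
    (M : Matrix (BitStr n) (BitStr n) ℝ) : Prop :=
  ∃ (x y : BitStr n → (Fin m → ℝ)),
    (∀ a, x a ∈ K) ∧ (∀ b, y b ∈ K) ∧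
    ∀ a b, M a b = ∑ i, x a i * y b i

/-- The set `A_K(n)` of nonnegative `2^n × 2^n` matrices admitting a `K`-factorization
and vanishing on all pairs with `aᵀb = 1`. -/
def AtomsCone {m : ℕ} (K : Set (Fin m → ℝ)) (n : ℕ) :
    Set (Matrix (BitStr n) (BitStr n) ℝ) :=
  {M | (∀ a b, 0 ≤ M a b) ∧ HasConeFactorization K M ∧
    ∀ a b, bitIP a b = 1 → M a b = 0}

/-- A rectangle: a set of pairs of the form `I × J`. -/
def IsRectangle {d : ℕ} (R : Finset (BitStr d × BitStr d)) : Prop :=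
  ∃ I J : Finset (BitStr d), R = I ×ˢ J

/-- The rectangles `R 0, …, R (k-1)` witness a `k`-uniform-covering of the set `S`:
each `R i` is a rectangle supported on the disjoint pairs, and for every `M ∈ S`
there is an injective map `φ` sending each disjoint pair on which `M` is positive
to (the index of) a rectangle containing that pair. -/
def UniformCoveringWith {d : ℕ} (S : Set (Matrix (BitStr d) (BitStr d) ℝ)) {k : ℕ}
    (R : Fin k → Finset (BitStr d × BitStr d)) : Prop :=
  (∀ i, IsRectangle (R i)) ∧
  (∀ i, ∀ p ∈ R i, bitIP p.1 p.2 = 0) ∧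
  ∀ M ∈ S, ∃ φ : {p : BitStr d × BitStr d // bitIP p.1 p.2 = 0 ∧ 0 < M p.1 p.2} → Fin k,
    Function.Injective φ ∧ ∀ p, (p : BitStr d × BitStr d) ∈ R (φ p)

/-- The set `S` of `2^d × 2^d` nonnegative matrices has a `k`-uniform-covering. -/
def HasUniformCovering {d : ℕ} (S : Set (Matrix (BitStr d) (BitStr d) ℝ)) (k : ℕ) : Prop :=
  ∃ R : Fin k → Finset (BitStr d × BitStr d), UniformCoveringWith S R

theorem bitIP_append {p q : ℕ} (a c : BitStr p) (b e : BitStr q) :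
    bitIP (Fin.append a b : BitStr (p + q)) (Fin.append c e) = bitIP a c + bitIP b e := by
  simp only [bitIP, Fin.sum_univ_add, Fin.append_left, Fin.append_right]

theorem Fin.append_injective {α : Type*} {p q : ℕ} {a c : Fin p → α} {b e : Fin q → α}
    (h : Fin.append a b = Fin.append c e) : a = c ∧ b = e := by
  constructor
  · funext i
    simpa using congrFun h (Fin.castAdd q i)
  · funext i
    simpa using congrFun h (Fin.natAdd p i)

theorem Fin.exists_append {α : Type*} {p q : ℕ} (f : Fin (p + q) → α) :
    ∃ (a : Fin p → α) (b : Fin q → α), f = Fin.append a b :=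
  ⟨_, _, Fin.append_castAdd_natAdd.symm⟩

theorem ConvexCone.sum_mem_of_nonempty {m : ℕ} (K : ConvexCone ℝ (Fin m → ℝ)) {ι : Type*}
    {I : Finset ι} (hI : I.Nonempty) {x : ι → Fin m → ℝ} (hx : ∀ i, x i ∈ K) :
    ∑ i ∈ I, x i ∈ K :=
  Finset.sum_induction_nonempty x (· ∈ K) (fun _ _ ha hb => K.add_mem ha hb) hI
    fun i _ => hx i

/-- A matrix of `A_K(d)` has at most `k` positive disjoint entries. -/
theorem UniformCoveringWith.valM_le {d k : ℕ} {S : Set (Matrix (BitStr d) (BitStr d) ℝ)}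
    {R : Fin k → Finset (BitStr d × BitStr d)} (hR : UniformCoveringWith S R)
    {M : Matrix (BitStr d) (BitStr d) ℝ} (hM : M ∈ S) : valM M ≤ k := by
  classical
  obtain ⟨φ, hφ, -⟩ := hR.2.2 M hM
  have h := Fintype.card_le_of_injective φ hφ
  rwa [Fintype.card_subtype, Fintype.card_fin] at h

/-- Fixing a disjoint pair of strings on the last coordinates stays within the atoms. -/
theorem AtomsCone.restrict {m : ℕ} {K : Set (Fin m → ℝ)} {t s u : ℕ}
    {M : Matrix (BitStr (t + (s + u))) (BitStr (t + (s + u))) ℝ}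
    (hM : M ∈ AtomsCone K (t + (s + u))) {a b : BitStr u} (hab : bitIP a b = 0) :
    (fun p q => M
      (Fin.append (fun i => p (Fin.castAdd s i)) (Fin.append (fun i => p (Fin.natAdd t i)) a))
      (Fin.append (fun i => q (Fin.castAdd s i)) (Fin.append (fun i => q (Fin.natAdd t i)) b)) :
        Matrix (BitStr (t + s)) (BitStr (t + s)) ℝ) ∈ AtomsCone K (t + s) := by
  obtain ⟨h0, ⟨x, y, hx, hy, hxy⟩, h1⟩ := hM
  refine ⟨fun _ _ => h0 _ _, ⟨fun p => x _, fun q => y _, fun _ => hx _, fun _ => hy _,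
    fun _ _ => hxy _ _⟩, fun p q hpq => h1 _ _ ?_⟩
  obtain ⟨p₁, p₂, rfl⟩ := Fin.exists_append p
  obtain ⟨q₁, q₂, rfl⟩ := Fin.exists_append q
  simpa [bitIP_append, hab] using hpq

/-- Summing over a nonempty rectangle of disjoint pairs on the first coordinates stays within
the atoms. -/
theorem AtomsCone.sum_rectangle {m : ℕ} {K : ConvexCone ℝ (Fin m → ℝ)} {t v : ℕ}
    {M : Matrix (BitStr (t + v)) (BitStr (t + v)) ℝ}
    (hM : M ∈ AtomsCone (K : Set (Fin m → ℝ)) (t + v))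
    {I J : Finset (BitStr t)} (hI : I.Nonempty) (hJ : J.Nonempty)
    (hIJ : ∀ α ∈ I, ∀ β ∈ J, bitIP α β = 0) :
    (fun c e => ∑ α ∈ I, ∑ β ∈ J, M (Fin.append α c) (Fin.append β e) :
      Matrix (BitStr v) (BitStr v) ℝ) ∈ AtomsCone (K : Set (Fin m → ℝ)) v := by
  obtain ⟨h0, ⟨x, y, hx, hy, hxy⟩, h1⟩ := hM
  refine ⟨fun c e => Finset.sum_nonneg fun α _ => Finset.sum_nonneg fun β _ => h0 _ _,
    ⟨fun c => ∑ α ∈ I, x (Fin.append α c), fun e => ∑ β ∈ J, y (Fin.append β e),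
      fun c => K.sum_mem_of_nonempty hI fun _ => hx _,
      fun e => K.sum_mem_of_nonempty hJ fun _ => hy _, fun c e => ?_⟩,
    fun c e hce => Finset.sum_eq_zero fun α hα => Finset.sum_eq_zero fun β hβ => h1 _ _ ?_⟩
  · simp only [hxy, Finset.sum_apply, Finset.sum_mul_sum]
    rw [Finset.sum_comm (s := Finset.univ)]
    exact Finset.sum_congr rfl fun α _ => Finset.sum_comm
  · rw [bitIP_append, hIJ α hα β hβ, hce]

/-- A rectangle of disjoint pairs on the first `t + s` coordinates meets the positive entries of
`M` over few disjoint pairs on the last `u` coordinates: at most as many as the number of positive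
disjoint entries of some atom on the last `s + u` coordinates. -/
theorem AtomsCone.card_outer_le {m : ℕ} {K : ConvexCone ℝ (Fin m → ℝ)} {t s u B : ℕ}
    {M : Matrix (BitStr (t + (s + u))) (BitStr (t + (s + u))) ℝ}
    (hM : M ∈ AtomsCone (K : Set (Fin m → ℝ)) (t + (s + u)))
    (hB : ∀ N ∈ AtomsCone (K : Set (Fin m → ℝ)) (s + u), valM N ≤ B)
    {R : Finset (BitStr (t + s) × BitStr (t + s))} (hR : IsRectangle R)
    (hR0 : ∀ p ∈ R, bitIP p.1 p.2 = 0) (C : Finset (BitStr u × BitStr u))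
    (hC : ∀ w ∈ C, bitIP w.1 w.2 = 0 ∧ ∃ p₁ p₂ q₁ q₂,
      (Fin.append p₁ p₂, Fin.append q₁ q₂) ∈ R ∧
      0 < M (Fin.append p₁ (Fin.append p₂ w.1)) (Fin.append q₁ (Fin.append q₂ w.2))) :
    C.card ≤ B := by
  classical
  obtain rfl | ⟨w₀, hw₀⟩ := C.eq_empty_or_nonempty
  · simp
  obtain ⟨I, J, rfl⟩ := hR
  obtain ⟨-, p₁, p₂, q₁, q₂, hpq, -⟩ := hC w₀ hw₀
  rw [Finset.mem_product] at hpq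
  let left : BitStr (t + s) → BitStr t := fun p i => p (Fin.castAdd s i)
  have left_append (a : BitStr t) (b : BitStr s) : left (Fin.append a b) = a := by
    funext i
    simp [left]
  have hN := AtomsCone.sum_rectangle hM (I := I.image left) (J := J.image left)
    ⟨_, Finset.mem_image_of_mem _ hpq.1⟩ ⟨_, Finset.mem_image_of_mem _ hpq.2⟩ (by
      simp only [Finset.mem_image]
      rintro _ ⟨p, hp, rfl⟩ _ ⟨q, hq, rfl⟩
      have h := hR0 (p, q) (Finset.mem_product.2 ⟨hp, hq⟩)
      obtain ⟨p₁, p₂, rfl⟩ := Fin.exists_append p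
      obtain ⟨q₁, q₂, rfl⟩ := Fin.exists_append q
      rw [bitIP_append] at h
      rw [left_append, left_append]
      lia)
  refine le_trans ?_ (hB _ hN)
  refine Finset.card_le_card_of_forall_subsingleton
    (fun w z => ∃ c e, z = (Fin.append c w.1, Fin.append e w.2)) ?_ ?_
  · intro w hw
    obtain ⟨hw0, p₁, p₂, q₁, q₂, hpq, hpos⟩ := hC w hw
    have h0 := hR0 _ hpq
    rw [Finset.mem_product] at hpq
    rw [bitIP_append] at h0
    refine ⟨_, Finset.mem_filter.2 ⟨Finset.mem_univ _, ?_, ?_⟩, p₂, q₂, rfl⟩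
    · rw [bitIP_append]
      lia
    · have hp : p₁ ∈ I.image left := Finset.mem_image.2 ⟨_, hpq.1, left_append _ _⟩
      have hq : q₁ ∈ J.image left := Finset.mem_image.2 ⟨_, hpq.2, left_append _ _⟩
      refine Finset.sum_pos' (fun _ _ => Finset.sum_nonneg fun _ _ => hM.1 _ _) ⟨p₁, hp, ?_⟩
      exact Finset.sum_pos' (fun _ _ => hM.1 _ _) ⟨q₁, hq, hpos⟩
  · rintro z - w ⟨-, c, e, rfl⟩ w' ⟨-, c', e', h⟩
    rw [Prod.mk.injEq] at h
    exact Prod.ext (Fin.append_injective h.1).2 (Fin.append_injective h.2).2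

/-- Splitting off the first `t` of the `t + s + u` coordinates costs a factor `k`. -/
theorem UniformCoveringWith.valM_le_mul {m : ℕ} {K : ConvexCone ℝ (Fin m → ℝ)} {t s u k B : ℕ}
    {R : Fin k → Finset (BitStr (t + s) × BitStr (t + s))}
    (hR : UniformCoveringWith (AtomsCone (K : Set (Fin m → ℝ)) (t + s)) R)
    {M : Matrix (BitStr (t + (s + u))) (BitStr (t + (s + u))) ℝ}
    (hM : M ∈ AtomsCone (K : Set (Fin m → ℝ)) (t + (s + u)))
    (hB : ∀ N ∈ AtomsCone (K : Set (Fin m → ℝ)) (s + u), valM N ≤ B) :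
    valM M ≤ k * B := by
  classical
  obtain ⟨hrect, hdisj, hcov⟩ := hR
  let C (i : Fin k) : Finset (BitStr u × BitStr u) := {w | bitIP w.1 w.2 = 0 ∧ ∃ p₁ p₂ q₁ q₂,
      (Fin.append p₁ p₂, Fin.append q₁ q₂) ∈ R i ∧
      0 < M (Fin.append p₁ (Fin.append p₂ w.1)) (Fin.append q₁ (Fin.append q₂ w.2))}
  have hC (i : Fin k) : (C i).card ≤ B :=
    AtomsCone.card_outer_le hM hB (hrect i) (hdisj i) (C i) fun w hw => (Finset.mem_filter.1 hw).2
  have hsum : (Finset.univ.sigma C).card ≤ k * B := by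
    rw [Finset.card_sigma]
    simpa using Finset.sum_le_card_nsmul Finset.univ (fun i => (C i).card) B fun i _ => hC i
  refine le_trans ?_ hsum
  choose φ hφ hφR using fun (w : {w : BitStr u × BitStr u // bitIP w.1 w.2 = 0}) =>
    hcov _ (AtomsCone.restrict hM w.2)
  refine Finset.card_le_card_of_forall_subsingleton
    (fun z y => ∃ p₁ p₂ q₁ q₂,
      z = (Fin.append p₁ (Fin.append p₂ y.2.1), Fin.append q₁ (Fin.append q₂ y.2.2)) ∧
      ∃ h h', φ ⟨y.2, h⟩ ⟨(Fin.append p₁ p₂, Fin.append q₁ q₂), h'⟩ = y.1) ?_ ?_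
  · rintro ⟨A, A'⟩ hA
    obtain ⟨p₁, v, rfl⟩ := Fin.exists_append A
    obtain ⟨p₂, a, rfl⟩ := Fin.exists_append v
    obtain ⟨q₁, v', rfl⟩ := Fin.exists_append A'
    obtain ⟨q₂, b, rfl⟩ := Fin.exists_append v'
    obtain ⟨-, h0, hpos⟩ := Finset.mem_filter.1 hA
    simp only [bitIP_append] at h0
    have hab : bitIP a b = 0 := by lia
    have h' : bitIP (Fin.append p₁ p₂) (Fin.append q₁ q₂) = 0 := by
      rw [bitIP_append]
      lia
    refine ⟨⟨φ ⟨(a, b), hab⟩ ⟨(Fin.append p₁ p₂, Fin.append q₁ q₂), h', by simpa using hpos⟩,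
      (a, b)⟩, ?_, p₁, p₂, q₁, q₂, rfl, hab, _, rfl⟩
    simp only [Finset.mem_sigma, Finset.mem_univ, true_and]
    exact Finset.mem_filter.2 ⟨Finset.mem_univ _, hab, p₁, p₂, q₁, q₂, hφR ⟨(a, b), hab⟩ _, hpos⟩
  · rintro ⟨i, a, b⟩ - z ⟨-, p₁, p₂, q₁, q₂, rfl, h, h', hi⟩
      z' ⟨-, p₁', p₂', q₁', q₂', rfl, _, h'', hi'⟩
    have heq := congrArg Subtype.val (hφ _ (hi.trans hi'.symm))
    rw [Prod.mk.injEq] at heq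
    obtain ⟨rfl, rfl⟩ := Fin.append_injective heq.1
    obtain ⟨rfl, rfl⟩ := Fin.append_injective heq.2
    rfl

/-- If `K ⊆ ℝ^m` is a convex cone, `d ≥ 1`, and `A_K(d)` has a `k`-uniform-covering,
then for every `n ≥ d` and every `M ∈ A_K(n)` we have `val(M) ≤ k^{⌊(n-1)/d⌋ + 1}`. -/
theorem val_le_of_uniformCovering {m : ℕ} (K : ConvexCone ℝ (Fin m → ℝ))
    (d : ℕ) (hd : 1 ≤ d) (k : ℕ)
    (hcov : HasUniformCovering (AtomsCone (K : Set (Fin m → ℝ)) d) k)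
    (n : ℕ) (hn : d ≤ n) (M : Matrix (BitStr n) (BitStr n) ℝ)
    (hM : M ∈ AtomsCone (K : Set (Fin m → ℝ)) n) :
    valM M ≤ k ^ ((n - 1) / d + 1) := by
  obtain ⟨R, hR⟩ := hcov
  induction n using Nat.strong_induction_on with
  | _ n ih =>
    obtain rfl | hlt := hn.eq_or_lt
    · simpa [Nat.div_eq_of_lt (show d - 1 < d by lia)] using hR.valM_le hM
    · obtain ⟨t, s, u, rfl, rfl, hsu, ht, hexp⟩ : ∃ t s u, d = t + s ∧ n = t + (s + u) ∧
          t + s ≤ s + u ∧ 0 < t ∧ (n - 1) / d = (s + u - 1) / d + 1 := by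
        obtain h | h := le_total (2 * d) n
        · refine ⟨d, 0, n - d, by lia, by lia, by lia, by lia, ?_⟩
          rw [show n - 1 = (0 + (n - d) - 1) + d by lia, Nat.add_div_right _ (by lia)]
        · refine ⟨n - d, 2 * d - n, n - d, by lia, by lia, by lia, by lia, ?_⟩
          rw [show n - 1 = (n - 1 - d) + d by lia, Nat.add_div_right _ (by lia),
            Nat.div_eq_of_lt (by lia), Nat.div_eq_of_lt (by lia)]
      rw [hexp, pow_succ']
      exact hR.valM_le_mul hM fun N hN => ih (s + u) (by lia) hsu N hN
end

section
/- Let K ⊆ ℝ^m be a convex cone, let d ∈ ℕ, and assume A_K(d) has a k-uniform-covering with rectangles R_1,…,R_k. Let n ≥ d and let M ∈ A_K(n). Consider the block decomposition of M into blocks M^{x,y} ∈ ℝ^{2^{n−d} × 2^{n−d}} indexed by (x,y) ∈ {0,1}^d × {0,1}^d, defined by M^{x,y}[a,b] = M[x∘a, y∘b] for (a,b) ∈ {0,1}^{n−d} × {0,1}^{n−d} (where ∘ denotes concatenation of bit strings). For i = 1,…,k define M_i = Σ_{(x,y) ∈ R_i} M^{x,y}. Then each M_i belongs to A_K(n−d),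 and val_n(M) ≤ Σ_{i=1}^{k} val_{n−d}(M_i). -/
/-- Concatenation `x ∘ a` of a bit string `x` of length `d` with a bit string `a` of
length `n - d`, giving a bit string of length `n` (for `d ≤ n`). -/
def bitConcat {d n : ℕ} (hn : d ≤ n) (x : BitStr d) (a : BitStr (n - d)) : BitStr n :=
  fun i => Fin.append x a (Fin.cast (Nat.add_sub_cancel' hn).symm i)

theorem bitIP_bitConcat {d n : ℕ} (hn : d ≤ n) (x y : BitStr d) (a b : BitStr (n - d)) :
    bitIP (bitConcat hn x a) (bitConcat hn y b) = bitIP x y + bitIP a b := by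
  unfold bitIP bitConcat
  rw [← Equiv.sum_comp (finCongr (Nat.add_sub_cancel' hn)), Fin.sum_univ_add]
  simp

/-- Concatenation of bit strings as an equivalence. -/
def bitConcatEquiv {d n : ℕ} (hn : d ≤ n) : BitStr d × BitStr (n - d) ≃ BitStr n :=
  (Fin.appendEquiv d (n - d)).trans
    (Equiv.arrowCongr (finCongr (Nat.add_sub_cancel' hn)) (Equiv.refl Bool))

theorem bitConcatEquiv_apply {d n : ℕ} (hn : d ≤ n) (p : BitStr d × BitStr (n - d)) :
    bitConcatEquiv hn p = bitConcat hn p.1 p.2 := rfl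

theorem exists_bitIP_eq_one {n : ℕ} (hn : 1 ≤ n) : ∃ a b : BitStr n, bitIP a b = 1 := by
  refine ⟨Pi.single ⟨0, hn⟩ true, Pi.single ⟨0, hn⟩ true, ?_⟩
  unfold bitIP
  rw [Finset.sum_eq_single ⟨0, hn⟩]
  · simp
  · intro i _ hi
    simp [Pi.single_eq_of_ne hi]
  · simp

theorem ConvexCone.sum_mem_of_nonempty_s5 {E ι : Type*} [AddCommMonoid E] [Module ℝ E]
    (K : ConvexCone ℝ E) {s : Finset ι} (hs : s.Nonempty) {f : ι → E}
    (hf : ∀ i ∈ s, f i ∈ K) : ∑ i ∈ s, f i ∈ K :=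
  Finset.sum_induction_nonempty f (· ∈ K) (fun _ _ ha hb => K.add_mem ha hb) hs hf

/-- Summing the blocks of `M` over a rectangle of disjoint pairs stays in `A_K`. -/
theorem sum_blocks_mem_atomsCone {m d n : ℕ} {K : ConvexCone ℝ (Fin m → ℝ)} (hd : 1 ≤ d)
    (hn : d ≤ n) {M : Matrix (BitStr n) (BitStr n) ℝ}
    (hM : M ∈ AtomsCone (K : Set (Fin m → ℝ)) n)
    {R : Finset (BitStr d × BitStr d)} (hR : IsRectangle R)
    (hdisj : ∀ p ∈ R, bitIP p.1 p.2 = 0) :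
    (fun a b => ∑ p ∈ R, M (bitConcat hn p.1 a) (bitConcat hn p.2 b)) ∈
      AtomsCone (K : Set (Fin m → ℝ)) (n - d) := by
  obtain ⟨hpos, ⟨x, y, hx, hy, hxy⟩, hzero⟩ := hM
  refine ⟨fun a b => Finset.sum_nonneg fun p _ => hpos _ _, ?_, fun a b hab =>
    Finset.sum_eq_zero fun p hp => hzero _ _ ?_⟩
  · obtain ⟨I, J, rfl⟩ := hR
    rcases (I ×ˢ J).eq_empty_or_nonempty with h | h
    · -- `0` need not lie in `K`, but `M` has a zero entry since `n ≥ 1`.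
      obtain ⟨a₀, b₀, h₀⟩ := exists_bitIP_eq_one (hd.trans hn)
      refine ⟨fun _ => x a₀, fun _ => y b₀, fun _ => hx _, fun _ => hy _, fun a b => ?_⟩
      rw [← hxy, hzero _ _ h₀]
      simp [h]
    · obtain ⟨hI, hJ⟩ := Finset.nonempty_product.mp h
      refine ⟨fun a => ∑ u ∈ I, x (bitConcat hn u a), fun b => ∑ v ∈ J, y (bitConcat hn v b),
        fun a => K.sum_mem_of_nonempty_s5 hI fun _ _ => hx _,
        fun b => K.sum_mem_of_nonempty_s5 hJ fun _ _ => hy _, fun a b => ?_⟩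
      simp only [hxy, Finset.sum_apply, Finset.sum_mul_sum, Finset.sum_product]
      exact Finset.sum_comm_cycle
  · rw [bitIP_bitConcat, hdisj p hp, hab]

/-- Fixing disjoint suffixes `a`, `b` in `M ∈ A_K(n)` gives a matrix in `A_K(d)`. -/
theorem slice_mem_atomsCone {m d n : ℕ} {K : Set (Fin m → ℝ)} (hn : d ≤ n)
    {M : Matrix (BitStr n) (BitStr n) ℝ} (hM : M ∈ AtomsCone K n)
    {a b : BitStr (n - d)} (hab : bitIP a b = 0) :
    (fun x y => M (bitConcat hn x a) (bitConcat hn y b)) ∈ AtomsCone K d := by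
  obtain ⟨hpos, ⟨x, y, hx, hy, hxy⟩, hzero⟩ := hM
  exact ⟨fun _ _ => hpos _ _, ⟨fun u => x (bitConcat hn u a), fun v => y (bitConcat hn v b),
    fun _ => hx _, fun _ => hy _, fun _ _ => hxy _ _⟩,
    fun u v huv => hzero _ _ (by rw [bitIP_bitConcat, huv, hab])⟩

/-- A covered matrix has at most as many positive disjoint entries as there are rectangles on
which its entry sum is positive. -/
theorem UniformCoveringWith.valM_le_s5 {d k : ℕ} {S : Set (Matrix (BitStr d) (BitStr d) ℝ)}
    {R : Fin k → Finset (BitStr d × BitStr d)} (h : UniformCoveringWith S R)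
    {N : Matrix (BitStr d) (BitStr d) ℝ} (hN : N ∈ S) (hpos : ∀ x y, 0 ≤ N x y) :
    valM N ≤ (Finset.univ.filter fun i => 0 < ∑ p ∈ R i, N p.1 p.2).card := by
  obtain ⟨φ, hφ, hmem⟩ := h.2.2 N hN
  rw [valM, ← Fintype.card_subtype, ← Fintype.card_subtype]
  refine Fintype.card_le_of_injective (fun p => ⟨φ p, ?_⟩) fun p q hpq =>
    hφ (congrArg Subtype.val hpq)
  exact p.2.2.trans_le
    (Finset.single_le_sum (f := fun q => N q.1 q.2) (fun q _ => hpos _ _) (hmem p))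

/-- `valM M` as a sum over disjoint suffix pairs of the values of the corresponding slices. -/
theorem valM_eq_sum_slices {d n : ℕ} (hn : d ≤ n) (M : Matrix (BitStr n) (BitStr n) ℝ) :
    valM M = ∑ q : BitStr (n - d) × BitStr (n - d) with bitIP q.1 q.2 = 0,
      valM fun x y => M (bitConcat hn x q.1) (bitConcat hn y q.2) := by
  simp only [valM, Finset.card_filter]
  rw [Finset.sum_filter, ← Equiv.sum_comp ((Equiv.prodProdProdComm _ _ _ _).trans
    (Equiv.prodCongr (bitConcatEquiv hn) (bitConcatEquiv hn))), Fintype.sum_prod_type_right]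
  refine Finset.sum_congr rfl fun q _ => ?_
  split_ifs with hq <;>
    simp [bitConcatEquiv_apply, bitIP_bitConcat, hq]

/-- **Induction lemma.** Let `K ⊆ ℝ^m` be a convex cone, `d ≥ 1`, and suppose `A_K(d)`
has a `k`-uniform-covering with rectangles `R 0, …, R (k-1)`. Let `n ≥ d` and
`M ∈ A_K(n)`, with block decomposition `Mblk x y [a, b] = M[x∘a, y∘b]` into blocks
indexed by `(x,y) ∈ {0,1}^d × {0,1}^d`. Put `Mi i = Σ_{(x,y) ∈ R i} Mblk x y`. Then each
`Mi i ∈ A_K(n-d)` and `val_n(M) ≤ Σ_{i} val_{n-d}(Mi i)`. -/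
theorem induction_lemma_uniformCovering {m : ℕ} (K : ConvexCone ℝ (Fin m → ℝ))
    (d : ℕ) (hd : 1 ≤ d) (k : ℕ) (R : Fin k → Finset (BitStr d × BitStr d))
    (hcov : UniformCoveringWith (AtomsCone (K : Set (Fin m → ℝ)) d) R)
    (n : ℕ) (hn : d ≤ n)
    (M : Matrix (BitStr n) (BitStr n) ℝ)
    (hM : M ∈ AtomsCone (K : Set (Fin m → ℝ)) n)
    (Mblk : BitStr d → BitStr d → Matrix (BitStr (n - d)) (BitStr (n - d)) ℝ)
    (hblk : ∀ x y a b, Mblk x y a b = M (bitConcat hn x a) (bitConcat hn y b))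
    (Mi : Fin k → Matrix (BitStr (n - d)) (BitStr (n - d)) ℝ)
    (hMi : ∀ i, Mi i = ∑ p ∈ R i, Mblk p.1 p.2) :
    (∀ i, Mi i ∈ AtomsCone (K : Set (Fin m → ℝ)) (n - d)) ∧
    valM M ≤ ∑ i, valM (Mi i) := by
  have hMi' : ∀ i, Mi i = fun a b =>
      ∑ p ∈ R i, M (bitConcat hn p.1 a) (bitConcat hn p.2 b) := by
    intro i
    ext a b
    simp [hMi, Matrix.sum_apply, hblk]
  refine ⟨fun i => hMi' i ▸ sum_blocks_mem_atomsCone hd hn hM (hcov.1 i) (hcov.2.1 i), ?_⟩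
  calc valM M
      = ∑ q : BitStr (n - d) × BitStr (n - d) with bitIP q.1 q.2 = 0,
          valM fun x y => M (bitConcat hn x q.1) (bitConcat hn y q.2) :=
        valM_eq_sum_slices hn M
    _ ≤ ∑ q : BitStr (n - d) × BitStr (n - d) with bitIP q.1 q.2 = 0,
          (Finset.univ.filter fun i => 0 < Mi i q.1 q.2).card := by
        refine Finset.sum_le_sum fun q hq => ?_
        simp only [hMi']
        exact hcov.valM_le_s5 (slice_mem_atomsCone hn hM (Finset.mem_filter.mp hq).2)
          fun _ _ => hM.1 _ _
    _ = ∑ i, valM (Mi i) := by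
        simp only [valM, Finset.card_filter]
        rw [Finset.sum_comm]
        refine Finset.sum_congr rfl fun i _ => ?_
        rw [Finset.sum_filter]
        refine Finset.sum_congr rfl fun q _ => ?_
        rw [ite_and]
end

section
/- The set A_{S^2_+}(2), consisting of nonnegative 4×4 matrices M indexed by {0,1}^2 × {0,1}^2 that admit an S^2_+-factorization and satisfy M_{a,b} = 0 whenever aᵀb = 1, has a 7-uniform-covering. -/
/-- The set `A_{S^d_+}(n)` of nonnegative `2^n × 2^n` matrices admitting an
`S^d_+`-factorization and vanishing on all pairs with `aᵀb = 1`. -/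
def AtomsPsd (d n : ℕ) : Set (Matrix (BitStr n) (BitStr n) ℝ) :=
  {M | (∀ a b, 0 ≤ M a b) ∧ HasPsdFactorization d M ∧
    ∀ a b, bitIP a b = 1 → M a b = 0}

namespace Matrix

open scoped MatrixOrder in
/-- Positive semidefinite real matrices that are orthogonal for the trace form have product zero. -/
theorem PosSemidef.mul_eq_zero_of_trace_mul_eq_zero_s6 {n : Type*} [Fintype n] [DecidableEq n]
    {A B : Matrix n n ℝ} (hA : A.PosSemidef) (hB : B.PosSemidef) (h : (A * B).trace = 0) :
    A * B = 0 := by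
  obtain ⟨C, rfl⟩ := CStarAlgebra.nonneg_iff_eq_star_mul_self.mp hA.nonneg
  obtain ⟨D, rfl⟩ := CStarAlgebra.nonneg_iff_eq_star_mul_self.mp hB.nonneg
  rw [star_eq_conjTranspose, star_eq_conjTranspose] at *
  have hCD : C * Dᴴ = 0 := by
    rw [← trace_mul_conjTranspose_self_eq_zero_iff, conjTranspose_mul,
      conjTranspose_conjTranspose, trace_mul_comm, ← h, trace_mul_comm (Cᴴ * C)]
    simp only [Matrix.mul_assoc]
    rw [trace_mul_comm Dᴴ]
    simp only [Matrix.mul_assoc]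
  rw [Matrix.mul_assoc, ← Matrix.mul_assoc C, hCD, Matrix.zero_mul, Matrix.mul_zero]

/-- Two symmetric `2 × 2` matrices annihilating the same nonzero matrix are proportional. -/
theorem IsSymm.exists_eq_smul_of_mul_eq_zero {K : Type*} [Field K]
    {A A' B : Matrix (Fin 2) (Fin 2) K} (hA : A.IsSymm) (hA' : A'.IsSymm)
    (hB : B ≠ 0) (hA0 : A ≠ 0) (hAB : A * B = 0) (hAB' : A' * B = 0) : ∃ t : K, A' = t • A := by
  obtain ⟨j, hj⟩ : ∃ j, B 0 j ≠ 0 ∨ B 1 j ≠ 0 := by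
    by_contra! hz
    exact hB (by ext i j; fin_cases i <;> simp [hz j])
  have key : ∀ S : Matrix (Fin 2) (Fin 2) K, S * B = 0 → ∀ i, S i 0 * B 0 j + S i 1 * B 1 j = 0 :=
    fun S hS i => by simpa [Matrix.mul_apply, Fin.sum_univ_two] using congrFun (congrFun hS i) j
  have hs := hA.apply 0 1
  have hs' := hA'.apply 0 1
  rcases hj with h0 | h1
  · have entries : ∀ S : Matrix (Fin 2) (Fin 2) K, S * B = 0 → S 1 0 = S 0 1 →
        S 0 1 = -(S 1 1 * (B 1 j / B 0 j)) ∧ S 0 0 = S 1 1 * (B 1 j / B 0 j) ^ 2 := by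
      intro S hS hsym
      have e0 := key S hS 0
      have e1 := key S hS 1
      rw [hsym] at e1
      constructor
      · field_simp; linear_combination e1
      · field_simp; linear_combination B 0 j * e0 - B 1 j * e1
    obtain ⟨p, q⟩ := entries A hAB hs
    obtain ⟨p', q'⟩ := entries A' hAB' hs'
    have hc : A 1 1 ≠ 0 := by
      intro hc
      refine hA0 ?_
      ext i k
      fin_cases i <;> fin_cases k <;> simp [hs, p, q, hc]
    refine ⟨A' 1 1 / A 1 1, ?_⟩
    ext i k
    fin_cases i <;> fin_cases k <;> simp [hs, hs', p, q, p', q'] <;> field_simp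
  · have entries : ∀ S : Matrix (Fin 2) (Fin 2) K, S * B = 0 → S 1 0 = S 0 1 →
        S 0 1 = -(S 0 0 * (B 0 j / B 1 j)) ∧ S 1 1 = S 0 0 * (B 0 j / B 1 j) ^ 2 := by
      intro S hS hsym
      have e0 := key S hS 0
      have e1 := key S hS 1
      rw [hsym] at e1
      constructor
      · field_simp; linear_combination e0
      · field_simp; linear_combination B 1 j * e1 - B 0 j * e0
    obtain ⟨p, q⟩ := entries A hAB hs
    obtain ⟨p', q'⟩ := entries A' hAB' hs'
    have hc : A 0 0 ≠ 0 := by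
      intro hc
      refine hA0 ?_
      ext i k
      fin_cases i <;> fin_cases k <;> simp [hs, p, q, hc]
    refine ⟨A' 0 0 / A 0 0, ?_⟩
    ext i k
    fin_cases i <;> fin_cases k <;> simp [hs, hs', p, q, p', q'] <;> field_simp

end Matrix

/-- In a matrix with an `S²₊`-factorization, zeros propagate: if rows `a`, `a'` vanish at
column `b`, columns `b`, `b'` vanish at row `a`, and row `a` and column `b` are both nonzero,
then the entry at `(a', b')` vanishes. -/
theorem HasPsdFactorization.apply_eq_zero {n : ℕ} {M : Matrix (BitStr n) (BitStr n) ℝ}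
    (hM : HasPsdFactorization 2 M) {a a' b b' c d : BitStr n} (hab : M a b = 0)
    (hab' : M a b' = 0) (ha'b : M a' b = 0) (had : M a d ≠ 0) (hcb : M c b ≠ 0) :
    M a' b' = 0 := by
  obtain ⟨X, Y, hX, hY, h⟩ := hM
  rw [h] at *
  have hXa : X a ≠ 0 := fun h0 => had (by simp [h0])
  have hYb : Y b ≠ 0 := fun h0 => hcb (by simp [h0])
  have hsymm : ∀ a, (X a).IsSymm := fun a => by simpa using (hX a).isHermitian
  obtain ⟨t, ht⟩ := (hsymm a).exists_eq_smul_of_mul_eq_zero (hsymm a') hYb hXa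
    ((hX a).mul_eq_zero_of_trace_mul_eq_zero_s6 (hY b) hab)
    ((hX a').mul_eq_zero_of_trace_mul_eq_zero_s6 (hY b) ha'b)
  rw [ht, Matrix.smul_mul, Matrix.trace_smul, hab', smul_zero]

/-- The number in `Fin 4` whose binary digits, least significant first, are the given bits. -/
def bitIndex (x : BitStr 2) : Fin 4 :=
  bif x 1 then bif x 0 then 3 else 2 else bif x 0 then 1 else 0

/-- The seven rectangles, with repetitions, of the uniform covering of `A_{S²₊}(2)`. -/
def coveringRectangle (i : Fin 7) : Finset (BitStr 2 × BitStr 2) :=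
  let o : BitStr 2 := ![false, false]
  let e : BitStr 2 := ![true, false]
  let f : BitStr 2 := ![false, true]
  ![{o} ×ˢ Finset.univ, {o} ×ˢ Finset.univ, {o, f} ×ˢ {o, e}, {o, f} ×ˢ {o, e},
    {o, e} ×ˢ {o, f}, {o, e} ×ˢ {o, f}, Finset.univ ×ˢ {o}] i

theorem isRectangle_coveringRectangle (i : Fin 7) : IsRectangle (coveringRectangle i) := by
  fin_cases i <;> exact ⟨_, _, rfl⟩

/-- The disjoint pairs different from `u` and `v`. -/
def disjointPairsExcept (u v : BitStr 2 × BitStr 2) : Finset (BitStr 2 × BitStr 2) :=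
  {p | bitIP p.1 p.2 = 0 ∧ p ≠ u ∧ p ≠ v}

/-- The table `T` assigns distinct rectangles containing them to all disjoint pairs except
`u` and `v`. -/
def IsCoveringTable (u v : BitStr 2 × BitStr 2) (T : Matrix (Fin 4) (Fin 4) (Fin 7)) : Prop :=
  (∀ p ∈ disjointPairsExcept u v, p ∈ coveringRectangle (T (bitIndex p.1) (bitIndex p.2))) ∧
  ∀ p ∈ disjointPairsExcept u v, ∀ q ∈ disjointPairsExcept u v,
    T (bitIndex p.1) (bitIndex p.2) = T (bitIndex q.1) (bitIndex q.2) → p = q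

/-- A covering table for `u` and `v` covers every matrix vanishing at `u` and `v`. -/
theorem IsCoveringTable.exists_injective {M : Matrix (BitStr 2) (BitStr 2) ℝ}
    {u v : BitStr 2 × BitStr 2} {T : Matrix (Fin 4) (Fin 4) (Fin 7)} (hT : IsCoveringTable u v T)
    (hu : M u.1 u.2 = 0) (hv : M v.1 v.2 = 0) :
    ∃ φ : {p : BitStr 2 × BitStr 2 // bitIP p.1 p.2 = 0 ∧ 0 < M p.1 p.2} → Fin 7,
      Function.Injective φ ∧ ∀ p, (p : BitStr 2 × BitStr 2) ∈ coveringRectangle (φ p) := by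
  have mem : ∀ p : {p : BitStr 2 × BitStr 2 // bitIP p.1 p.2 = 0 ∧ 0 < M p.1 p.2},
      (p : BitStr 2 × BitStr 2) ∈ disjointPairsExcept u v := by
    rintro ⟨p, hp, hp'⟩
    refine Finset.mem_filter.mpr ⟨Finset.mem_univ _, hp, ?_, ?_⟩ <;> rintro rfl
    exacts [hp'.ne' hu, hp'.ne' hv]
  exact ⟨fun p => T (bitIndex p.1.1) (bitIndex p.1.2),
    fun p q hpq => Subtype.ext (hT.2 p (mem p) q (mem q) hpq), fun p => hT.1 p (mem p)⟩

/-- The set `A_{S^2_+}(2)` has a 7-uniform-covering. -/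
theorem atomsPsd_two_uniformCovering_seven :
    HasUniformCovering (AtomsPsd 2 2) 7 := by
  refine ⟨coveringRectangle, isRectangle_coveringRectangle, by decide +kernel, ?_⟩
  rintro M ⟨-, hM, hz⟩
  let o : BitStr 2 := ![false, false]
  let e : BitStr 2 := ![true, false]
  let f : BitStr 2 := ![false, true]
  let g : BitStr 2 := ![true, true]
  have hee : M e e = 0 := hz _ _ (by decide)
  have hff : M f f = 0 := hz _ _ (by decide)
  have heg : M e g = 0 := hz _ _ (by decide)
  have hge : M g e = 0 := hz _ _ (by decide)
  have hfg : M f g = 0 := hz _ _ (by decide)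
  have hgf : M g f = 0 := hz _ _ (by decide)
  by_cases hef : M e f = 0 <;> by_cases hfe : M f e = 0
  · have hT : IsCoveringTable (e, f) (f, e)
        !![1, 2, 4, 0; 5, 0, 0, 0; 3, 0, 0, 0; 6, 0, 0, 0] :=
        ⟨by decide +kernel, by decide +kernel⟩
    exact hT.exists_injective hef hfe
  · by_cases hog : M o g = 0
    · have hT : IsCoveringTable (e, f) (o, g)
          !![5, 1, 0, 0; 4, 0, 0, 0; 3, 2, 0, 0; 6, 0, 0, 0] :=
          ⟨by decide +kernel, by decide +kernel⟩
      exact hT.exists_injective hef hog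
    · have heo : M e o = 0 := by
        by_contra heo
        exact hfe (hM.apply_eq_zero heg hee hfg heo hog)
      have hT : IsCoveringTable (e, f) (e, o)
          !![5, 1, 4, 0; 0, 0, 0, 0; 3, 2, 0, 0; 6, 0, 0, 0] :=
          ⟨by decide +kernel, by decide +kernel⟩
      exact hT.exists_injective hef heo
  · by_cases hog : M o g = 0
    · have hT : IsCoveringTable (f, e) (o, g)
          !![3, 0, 1, 0; 5, 0, 4, 0; 2, 0, 0, 0; 6, 0, 0, 0] :=
          ⟨by decide +kernel, by decide +kernel⟩
      exact hT.exists_injective hfe hog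
    · have hfo : M f o = 0 := by
        by_contra hfo
        exact hef (hM.apply_eq_zero hfg hff heg hfo hog)
      have hT : IsCoveringTable (f, e) (f, o)
          !![3, 2, 1, 0; 5, 0, 4, 0; 0, 0, 0, 0; 6, 0, 0, 0] :=
          ⟨by decide +kernel, by decide +kernel⟩
      exact hT.exists_injective hfe hfo
  · have hog : M o g = 0 := by
      by_contra hog
      exact hef (hM.apply_eq_zero hfg hff heg hfe hog)
    have hgo : M g o = 0 := by
      by_contra hgo
      exact hef (hM.apply_eq_zero hge hgf hee hgo hfe)
    have hT : IsCoveringTable (o, g) (g, o)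
        !![5, 0, 1, 0; 6, 0, 4, 0; 3, 2, 0, 0; 0, 0, 0, 0] :=
        ⟨by decide +kernel, by decide +kernel⟩
    exact hT.exists_injective hog hgo
end

section
/- Every matrix M ∈ A_{S^2_+}(2) satisfies val(M) ≤ 7; that is, any nonnegative 4×4 matrix M indexed by {0,1}^2 × {0,1}^2 that admits an S^2_+-factorization and satisfies M_{a,b} = 0 whenever aᵀb = 1 has at most 7 positive entries among the pairs (a,b) with aᵀb = 0. -/
open scoped MatrixOrder in
/-- If the trace of a product of two positive semidefinite matrices vanishes,
then so does the product. -/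
lemma Matrix.PosSemidef.mul_eq_zero_of_trace_mul_eq_zero_s7 {n : Type*} [Fintype n]
    {A B : Matrix n n ℝ} (hA : A.PosSemidef) (hB : B.PosSemidef)
    (h : (A * B).trace = 0) : A * B = 0 := by
  classical
  obtain ⟨S, rfl⟩ := CStarAlgebra.nonneg_iff_eq_star_mul_self.mp hA.nonneg
  obtain ⟨T, rfl⟩ := CStarAlgebra.nonneg_iff_eq_star_mul_self.mp hB.nonneg
  simp only [Matrix.star_eq_conjTranspose] at h ⊢
  have key : S * T.conjTranspose = 0 := by
    rw [← Matrix.trace_mul_conjTranspose_self_eq_zero_iff, Matrix.conjTranspose_mul,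
      Matrix.conjTranspose_conjTranspose, ← h, Matrix.mul_assoc S.conjTranspose,
      Matrix.trace_mul_comm S.conjTranspose]
    simp only [Matrix.mul_assoc]
  rw [Matrix.mul_assoc, ← Matrix.mul_assoc S, key, Matrix.zero_mul, Matrix.mul_zero]

/-- If `A ≠ 0` annihilates `C ≠ 0` and `D`, then the columns of `C` and `D` all lie on one line,
so every `B` that annihilates `C` also annihilates `D`. -/
lemma Matrix.mul_eq_zero_of_common_annihilator {K : Type*} [Field K]
    {A B C D : Matrix (Fin 2) (Fin 2) K} (hA : A ≠ 0) (hC : C ≠ 0)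
    (hAC : A * C = 0) (hAD : A * D = 0) (hBC : B * C = 0) : B * D = 0 := by
  obtain ⟨i, hi⟩ : ∃ i, A i ≠ 0 := Function.ne_iff.mp hA
  obtain ⟨k, hk⟩ : ∃ k, ¬ (C 0 k = 0 ∧ C 1 k = 0) := by
    by_contra! h
    apply hC
    ext r s
    fin_cases r
    · exact (h s).1
    · exact (h s).2
  have hi' : ¬ (A i 0 = 0 ∧ A i 1 = 0) := fun h => hi <| by
    ext r
    fin_cases r
    · exact h.1
    · exact h.2
  ext r s
  have h1 := congrFun (congrFun hAC i) k
  have h2 := congrFun (congrFun hAD i) s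
  have h3 := congrFun (congrFun hBC r) k
  simp only [Matrix.mul_apply, Fin.sum_univ_two, Matrix.zero_apply] at h1 h2 h3 ⊢
  have hdet : C 0 k * D 1 s = C 1 k * D 0 s := by
    by_cases h0 : A i 0 = 0
    · refine mul_left_cancel₀ (fun h => hi' ⟨h0, h⟩ : A i 1 ≠ 0) ?_
      linear_combination C 0 k * h2 - D 0 s * h1
    · refine mul_left_cancel₀ h0 ?_
      linear_combination D 1 s * h1 - C 1 k * h2
  by_cases h0 : C 0 k = 0
  · refine (mul_eq_zero.mp ?_).resolve_left (fun h => hk ⟨h0, h⟩ : C 1 k ≠ 0)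
    linear_combination D 1 s * h3 - B r 0 * hdet
  · refine (mul_eq_zero.mp ?_).resolve_left h0
    linear_combination D 0 s * h3 + B r 1 * hdet

lemma Matrix.PosSemidef.trace_mul_eq_zero_of_common_annihilator
    {A B C D : Matrix (Fin 2) (Fin 2) ℝ} (hA : A.PosSemidef) (hB : B.PosSemidef)
    (hC : C.PosSemidef) (hD : D.PosSemidef) (hA0 : A ≠ 0) (hC0 : C ≠ 0)
    (hAC : (A * C).trace = 0) (hAD : (A * D).trace = 0) (hBC : (B * C).trace = 0) :
    (B * D).trace = 0 := by
  rw [Matrix.mul_eq_zero_of_common_annihilator hA0 hC0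
    (hA.mul_eq_zero_of_trace_mul_eq_zero_s7 hC hAC) (hA.mul_eq_zero_of_trace_mul_eq_zero_s7 hD hAD)
    (hB.mul_eq_zero_of_trace_mul_eq_zero_s7 hC hBC), Matrix.trace_zero]

/-- Of the nine disjoint pairs, two nonpositive entries leave at most seven positive ones. -/
lemma valM_le_seven_of_two_nonpos (M : Matrix (BitStr 2) (BitStr 2) ℝ)
    {p q : BitStr 2 × BitStr 2} (hpq : p ≠ q) (hp : bitIP p.1 p.2 = 0) (hq : bitIP q.1 q.2 = 0)
    (hMp : M p.1 p.2 ≤ 0) (hMq : M q.1 q.2 ≤ 0) : valM M ≤ 7 := by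
  let S : Finset (BitStr 2 × BitStr 2) := Finset.univ.filter fun p => bitIP p.1 p.2 = 0
  have hS : S.card = 9 := by decide
  have hsub : (Finset.univ.filter fun p : BitStr 2 × BitStr 2 =>
      bitIP p.1 p.2 = 0 ∧ 0 < M p.1 p.2) ⊆ (S.erase p).erase q := by
    intro r hr
    obtain ⟨h0, hpos⟩ := (Finset.mem_filter.mp hr).2
    refine Finset.mem_erase.mpr ⟨?_, Finset.mem_erase.mpr ⟨?_, by simpa [S] using h0⟩⟩
    · rintro rfl
      exact hMq.not_gt hpos
    · rintro rfl
      exact hMp.not_gt hpos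
  have hpS : p ∈ S := by simpa [S] using hp
  have hqS : q ∈ S.erase p := Finset.mem_erase.mpr ⟨hpq.symm, by simpa [S] using hq⟩
  have hcard := Finset.card_le_card hsub
  rw [Finset.card_erase_of_mem hqS, Finset.card_erase_of_mem hpS, hS] at hcard
  exact hcard

/-- Every `M ∈ A_{S^2_+}(2)` satisfies `val(M) ≤ 7`. -/
theorem valM_le_seven_of_mem_atomsPsd_two
    (M : Matrix (BitStr 2) (BitStr 2) ℝ) (hM : M ∈ AtomsPsd 2 2) :
    valM M ≤ 7 := by
  obtain ⟨-, ⟨X, Y, hX, hY, hXY⟩, hzero⟩ := hM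
  have hX0 {a b} (h : 0 < M a b) : X a ≠ 0 := fun h0 => by simp [hXY, h0] at h
  have hY0 {a b} (h : 0 < M a b) : Y b ≠ 0 := fun h0 => by simp [hXY, h0] at h
  have hXYz {a b} (h : bitIP a b = 1) : (X a * Y b).trace = 0 := by rw [← hXY, hzero a b h]
  have hYXz {a b} (h : bitIP a b = 1) : (Y b * X a).trace = 0 := by
    rw [Matrix.trace_mul_comm, hXYz h]
  let o : BitStr 2 := ![false, false]
  let e : BitStr 2 := ![true, false]
  let f : BitStr 2 := ![false, true]
  let u : BitStr 2 := ![true, true]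
  by_contra hval
  have hpos {p q : BitStr 2 × BitStr 2} (hpq : p ≠ q) (hp : bitIP p.1 p.2 = 0)
      (hq : bitIP q.1 q.2 = 0) (hMp : M p.1 p.2 ≤ 0) : 0 < M q.1 q.2 := by
    by_contra! hMq
    exact hval (valM_le_seven_of_two_nonpos M hpq hp hq hMp hMq)
  have not_both (hef : M e f = 0) (hfe : M f e = 0) : False :=
    (hpos (p := (e, f)) (q := (f, e)) (by decide) (by decide) (by decide) hef.le).ne' hfe
  have hrow (huo : 0 < M u o) (hoe : 0 < M o e) (hof : 0 < M o f) : False := by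
    apply not_both
    · rw [hXY]
      exact (hX u).trace_mul_eq_zero_of_common_annihilator (hX e) (hY e) (hY f) (hX0 huo)
        (hY0 hoe) (hXYz (by decide)) (hXYz (by decide)) (hXYz (by decide))
    · rw [hXY]
      exact (hX u).trace_mul_eq_zero_of_common_annihilator (hX f) (hY f) (hY e) (hX0 huo)
        (hY0 hof) (hXYz (by decide)) (hXYz (by decide)) (hXYz (by decide))
  have hcol (hou : 0 < M o u) (heo : 0 < M e o) (hfo : 0 < M f o) : False := by
    apply not_both
    · rw [hXY, Matrix.trace_mul_comm]
      exact (hY u).trace_mul_eq_zero_of_common_annihilator (hY f) (hX f) (hX e) (hY0 hou)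
        (hX0 hfo) (hYXz (by decide)) (hYXz (by decide)) (hYXz (by decide))
    · rw [hXY, Matrix.trace_mul_comm]
      exact (hY u).trace_mul_eq_zero_of_common_annihilator (hY e) (hX e) (hX f) (hY0 hou)
        (hX0 heo) (hYXz (by decide)) (hYXz (by decide)) (hYXz (by decide))
  have hrow_pos {p : BitStr 2 × BitStr 2} (hp : bitIP p.1 p.2 = 0)
      (h1 : p ≠ (o, u)) (h2 : p ≠ (e, o)) (h3 : p ≠ (f, o)) : 0 < M p.1 p.2 := by
    by_contra! hMp
    exact hcol (hpos h1 hp (by decide) hMp) (hpos h2 hp (by decide) hMp)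
      (hpos h3 hp (by decide) hMp)
  exact hrow (hrow_pos (p := (u, o)) (by decide) (by decide) (by decide) (by decide))
    (hrow_pos (p := (o, e)) (by decide) (by decide) (by decide) (by decide))
    (hrow_pos (p := (o, f)) (by decide) (by decide) (by decide) (by decide))
end

section
/- For every d ≥ 1, the set A_{S^d_+}(d) has a (3^d − 1)-uniform-covering. -/
open scoped Matrix MatrixOrder Matrix.Norms.L2Operator in
theorem Matrix.PosSemidef.mul_eq_zero_of_trace_mul_eq_zero_s9 {n : Type*} [Fintype n]
    {X Y : Matrix n n ℝ} (hX : X.PosSemidef) (hY : Y.PosSemidef)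
    (h : (X * Y).trace = 0) : X * Y = 0 := by
  classical
  obtain ⟨A, rfl⟩ := CStarAlgebra.nonneg_iff_eq_star_mul_self.mp hX.nonneg
  obtain ⟨B, rfl⟩ := CStarAlgebra.nonneg_iff_eq_star_mul_self.mp hY.nonneg
  have hAB : A * star B = 0 := by
    rw [← Matrix.trace_conjTranspose_mul_self_eq_zero_iff, ← h, Matrix.star_eq_conjTranspose,
      Matrix.star_eq_conjTranspose, Matrix.conjTranspose_mul, Matrix.conjTranspose_conjTranspose,
      Matrix.mul_assoc B, Matrix.trace_mul_comm B]
    simp only [Matrix.mul_assoc]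
  rw [Matrix.mul_assoc, ← Matrix.mul_assoc A, hAB, Matrix.zero_mul, Matrix.mul_zero]

open scoped Matrix in
/-- A triangular pattern of vanishing and nonvanishing products bounds the size of the pattern
by the size of the matrices. -/
theorem Matrix.le_card_of_mul_triangular {n K : Type*} [Fintype n] [Field K] {m : ℕ}
    (X Y : Fin m → Matrix n n K) (hdiag : ∀ k, X k * Y k ≠ 0)
    (hlt : ∀ i k, i < k → X i * Y k = 0) : m ≤ Fintype.card n := by
  have hcol : ∀ k, ∃ j, X k *ᵥ (Y k).col j ≠ 0 := by
    intro k
    by_contra! hc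
    refine hdiag k (Matrix.ext fun i j => ?_)
    simpa [Matrix.mulVec, dotProduct, Matrix.mul_apply, Matrix.col] using congrFun (hc j) i
  choose j hj using hcol
  have hli : LinearIndependent K fun k => (Y k).col (j k) := by
    rw [Fintype.linearIndependent_iff]
    intro c hc i
    induction i using WellFoundedLT.induction with
    | _ i ih =>
      have h := congrArg (X i *ᵥ ·) hc
      simp only [Matrix.mulVec_sum, Matrix.mulVec_smul, Matrix.mulVec_zero] at h
      rw [Finset.sum_eq_single i] at h
      · exact (smul_eq_zero.1 h).resolve_right (hj i)
      · intro k _ hki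
        rcases lt_or_gt_of_ne hki with hk | hk
        · rw [ih k hk, zero_smul]
        · have h0 : X i *ᵥ (Y k).col (j k) = 0 := by
            ext l
            simpa [Matrix.mulVec, dotProduct, Matrix.mul_apply, Matrix.col] using
              congrFun (congrFun (hlt i k hk) l) (j k)
          rw [h0, smul_zero]
      · simp
  simpa using hli.fintype_card_le_finrank

/-- A matrix with a `d`-dimensional psd factorization that vanishes on the pairs with inner
product one also vanishes on some disjoint pair. -/
theorem exists_disjoint_eq_zero {d : ℕ} {M : Matrix (BitStr d) (BitStr d) ℝ}
    (hM : M ∈ AtomsPsd d d) : ∃ p : BitStr d × BitStr d, bitIP p.1 p.2 = 0 ∧ M p.1 p.2 = 0 := by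
  obtain ⟨-, ⟨X, Y, hX, hY, hXY⟩, hM⟩ := hM
  by_contra! hpos
  let a : Fin (d + 1) → BitStr d := fun k j => decide ((j : ℕ) = k)
  let b : Fin (d + 1) → BitStr d := fun k j => decide ((j : ℕ) < k)
  have h := Matrix.le_card_of_mul_triangular (fun k => X (a k)) (fun k => Y (b k)) ?_ ?_
  · simp at h
  · intro k hk
    refine hpos (a k, b k) ?_ ?_
    · refine Finset.sum_eq_zero fun j _ => ?_
      simp only [a, b, Bool.and_eq_true, decide_eq_true_eq, ite_eq_right_iff]
      lia
    · exact (hXY _ _).trans (by rw [hk, Matrix.trace_zero])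
  · intro i k hik
    refine (hX _).mul_eq_zero_of_trace_mul_eq_zero_s9 (hY _) ?_
    rw [← hXY]
    refine hM _ _ ?_
    have hid : (i : ℕ) < d := by lia
    rw [bitIP, Finset.sum_eq_single (⟨i, hid⟩ : Fin d)]
    · simpa [a, b] using hik
    · intro j _ hj
      have : (j : ℕ) ≠ i := fun h => hj (Fin.ext h)
      simp [a, this]
    · simp

theorem bitIP_eq_zero_iff {d : ℕ} (a b : BitStr d) :
    bitIP a b = 0 ↔ ∀ i, a i = true → b i = false := by
  simp [bitIP]

theorem card_disjoint_le (d : ℕ) :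
    Fintype.card {p : BitStr d × BitStr d // bitIP p.1 p.2 = 0} ≤ 3 ^ d := by
  have h := Fintype.card_le_of_injective
    (fun (p : {p : BitStr d × BitStr d // bitIP p.1 p.2 = 0}) (i : Fin d) =>
      (if p.1.1 i then 1 else if p.1.2 i then 2 else 0 : Fin 3)) ?_
  · simpa using h
  · rintro ⟨⟨a, b⟩, hab⟩ ⟨⟨a', b'⟩, hab'⟩ h
    rw [bitIP_eq_zero_iff] at hab hab'
    have key : ∀ i, a i = a' i ∧ b i = b' i := by
      intro i
      have h1 := congrFun h i
      have h2 := hab i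
      have h3 := hab' i
      dsimp only at h1 h2 h3
      cases ha : a i <;> cases ha' : a' i <;> cases hb : b i <;> cases hb' : b' i <;>
        simp [ha, ha', hb, hb'] at h1 h2 h3 ⊢
    simp only [Subtype.mk.injEq, Prod.mk.injEq]
    exact ⟨funext fun i => (key i).1, funext fun i => (key i).2⟩

/-- For every `d ≥ 1`, the set `A_{S^d_+}(d)` has a `(3^d - 1)`-uniform-covering. -/
theorem atomsPsd_uniformCovering (d : ℕ) (hd : 1 ≤ d) :
    HasUniformCovering (AtomsPsd d d) (3 ^ d - 1) := by
  classical
  let D := {p : BitStr d × BitStr d // bitIP p.1 p.2 = 0}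
  let z : BitStr d := fun _ => false
  let o : D := ⟨(z, z), by simp [bitIP_eq_zero_iff, z]⟩
  obtain ⟨e⟩ : Nonempty ({q : D // q ≠ o} ↪ Fin (3 ^ d - 1)) := by
    apply Function.Embedding.nonempty_of_card_le
    have := card_disjoint_le d
    simp only [Fintype.card_fin, Fintype.card_subtype_compl, Fintype.card_subtype_eq]
    exact Nat.sub_le_sub_right this 1
  let S : {q : D // q ≠ o} → Finset (BitStr d × BitStr d) :=
    fun q => {z, q.1.1.1} ×ˢ {z, q.1.1.2}
  have hS : ∀ i, Function.extend e S (fun _ => ∅) i = ∅ ∨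
      ∃ q, Function.extend e S (fun _ => ∅) i = S q := by
    intro i
    by_cases hi : ∃ q, e q = i
    · obtain ⟨q, rfl⟩ := hi
      exact Or.inr ⟨q, e.injective.extend_apply _ _ _⟩
    · exact Or.inl (Function.extend_apply' _ _ _ hi)
  refine ⟨Function.extend e S fun _ => ∅, fun i => ?_, fun i => ?_, fun M hM => ?_⟩
  · rcases hS i with h | ⟨q, h⟩
    · exact ⟨∅, ∅, by simp [h]⟩
    · exact ⟨_, _, h⟩
  · rcases hS i with h | ⟨q, h⟩
    · simp [h]
    · rw [h]
      rintro ⟨x, y⟩ hxy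
      have hq := (bitIP_eq_zero_iff _ _).1 q.1.2
      simp only [S, Finset.mem_product, Finset.mem_insert, Finset.mem_singleton] at hxy
      rw [bitIP_eq_zero_iff]
      rcases hxy with ⟨rfl | rfl, rfl | rfl⟩ <;> simp_all [z]
  · obtain ⟨p, hp, hMp⟩ := exists_disjoint_eq_zero hM
    let P : D := ⟨p, hp⟩
    let f : {p : BitStr d × BitStr d // bitIP p.1 p.2 = 0 ∧ 0 < M p.1 p.2} → D :=
      fun q => ⟨q.1, q.2.1⟩
    have hf : Function.Injective f := fun q r h => Subtype.ext (congrArg (fun t : D => t.1) h)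
    have hfP : ∀ q, f q ≠ P := fun q h => by
      have : q.1 = p := congrArg (fun t : D => t.1) h
      have h2 := q.2.2
      rw [this, hMp] at h2
      exact lt_irrefl _ h2
    have hswap : ∀ q, Equiv.swap o P (f q) ≠ o := fun q h =>
      hfP q ((Equiv.swap o P).injective (by rw [h, Equiv.swap_apply_right]))
    refine ⟨fun q => e ⟨Equiv.swap o P (f q), hswap q⟩, fun q r h => ?_, fun q => ?_⟩
    · exact hf ((Equiv.swap o P).injective (congrArg Subtype.val (e.injective h)))
    · rw [e.injective.extend_apply]
      by_cases hq : f q = o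
      · have : q.1 = (z, z) := congrArg (fun t : D => t.1) hq
        rw [this]
        simp [S]
      · have h1 := Equiv.swap_apply_of_ne_of_ne hq (hfP q)
        simp [S, h1, f]
end
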